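/- Let h: L → M and g: N → M be morphisms of differential graded Lie algebras over ℂ and (A, m_A) a local Artinian ℂ-algebra with residue field ℂ. Then the relation ∼ on MC_{(h,g)}(A), defined by (x₁,y₁,e^{p₁}) ∼ (x₂,y₂,e^{p₂}) iff there exist a ∈ L^0 ⊗ m_A, b ∈ N^0 ⊗ m_A and c ∈ M^{−1} ⊗ m_A such that x₂ = e^a * x₁, y₂ = e^b * y₁ and e^{p₂} = e^{g(b)} e^T e^{p₁} e^{−h(a)} with T = dc + [g(y₁), c], is an equivalence relation. -/

import Mathlib

noncomputable section

open TensorProduct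

/-- Raw graded Lie data: a `ℤ`-graded complex vector space with a degree-one
differential and a degree-zero bracket (no axioms). -/
structure GLD where
  V : ℤ → Type
  [grp : ∀ i, AddCommGroup (V i)]
  [mod : ∀ i, Module ℂ (V i)]
  d : ∀ i, V i → V (i + 1)
  br : ∀ i j, V i → V j → V (i + j)

attribute [instance] GLD.grp GLD.mod

namespace GLD

/-- Transport along an equality of degrees. -/
def tr (L : GLD) {i j : ℤ} (h : i = j) (x : L.V i) : L.V j := h ▸ x

/-- The Maurer-Cartan equation in degree one: `dx + ½[x,x] = 0`. -/
def MC1 (L : GLD) (x : L.V 1) : Prop :=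
  L.d 1 x + (2 : ℂ)⁻¹ • L.br 1 1 x x = 0

/-- The adjoint action of a degree-zero element on degree one. -/
def ad01 (L : GLD) (a : L.V 0) (x : L.V 1) : L.V 1 := L.tr (by omega) (L.br 0 1 a x)

/-- The adjoint action of a degree-zero element on degree zero. -/
def ad00 (L : GLD) (a : L.V 0) (x : L.V 0) : L.V 0 := L.tr (by omega) (L.br 0 0 a x)

/-- The gauge action `e^a * x = x + Σ_{n≥0} ad_a^n/(n+1)! ([a,x] - da)`. -/
def gauge (L : GLD) (a : L.V 0) (x : L.V 1) : L.V 1 :=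
  x + ∑ᶠ n : ℕ, (((n+1).factorial : ℂ))⁻¹ •
    (L.ad01 a)^[n] (L.ad01 a x - L.tr (by omega) (L.d 0 a))

/-- Right-nested bracket of a word in two degree-zero letters `x` (true) and `y` (false). -/
def nest (L : GLD) (x y : L.V 0) : List Bool → L.V 0
  | [] => 0
  | [b] => if b then x else y
  | b :: (c :: rest) => L.ad00 (if b then x else y) (L.nest x y (c :: rest))

end GLD

/-- The word `x^{r₁} y^{s₁} ⋯ x^{r_n} y^{s_n}` encoded as a list of booleans. -/
def bchWord (P : List (ℕ × ℕ)) : List Bool :=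
  P.flatMap fun p => List.replicate p.1 true ++ List.replicate p.2 false

open Classical in
/-- The coefficient in Dynkin's formula for the Baker-Campbell-Hausdorff series. -/
def bchCoeff (P : List (ℕ × ℕ)) : ℂ :=
  if P = [] ∨ ¬ (∀ p ∈ P, 0 < p.1 + p.2) then 0 else
    (-1 : ℂ) ^ (P.length - 1) / (P.length : ℂ) *
      ((((P.map fun p => p.1 + p.2).sum : ℕ) : ℂ) *
        (((P.map fun p => (p.1.factorial * p.2.factorial : ℕ)).prod : ℕ) : ℂ))⁻¹

/-- The Baker-Campbell-Hausdorff product on degree-zero elements, via Dynkin's formula. -/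
def GLD.bch (L : GLD) (x y : L.V 0) : L.V 0 :=
  ∑ᶠ P : List (ℕ × ℕ), bchCoeff P • L.nest x y (bchWord P)

/-- Differential graded Lie algebra over `ℂ`. -/
structure DGLA extends GLD where
  d_add : ∀ i (x y : V i), d i (x + y) = d i x + d i y
  d_smul : ∀ i (c : ℂ) (x : V i), d i (c • x) = c • d i x
  br_add_left : ∀ i j (x x' : V i) (y : V j), br i j (x + x') y = br i j x y + br i j x' y
  br_smul_left : ∀ i j (c : ℂ) (x : V i) (y : V j), br i j (c • x) y = c • br i j x y
  br_add_right : ∀ i j (x : V i) (y y' : V j), br i j x (y + y') = br i j x y + br i j x y'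
  br_smul_right : ∀ i j (c : ℂ) (x : V i) (y : V j), br i j x (c • y) = c • br i j x y
  d_sq : ∀ i (x : V i), d (i + 1) (d i x) = 0
  antisym : ∀ i j (x : V i) (y : V j),
    br i j x y = - toGLD.tr (by omega) (((Int.negOnePow (i * j) : ℤˣ) : ℤ) • br j i y x)
  leibniz : ∀ i j (x : V i) (y : V j),
    d (i + j) (br i j x y) =
      toGLD.tr (by omega) (br (i + 1) j (d i x) y) +
        ((Int.negOnePow i : ℤˣ) : ℤ) • toGLD.tr (by omega) (br i (j + 1) x (d j y))
  jacobi : ∀ i j k (x : V i) (y : V j) (z : V k),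
    br i (j + k) x (br j k y z) =
      toGLD.tr (by omega) (br (i + j) k (br i j x y) z) +
        ((Int.negOnePow (i * j) : ℤˣ) : ℤ) • toGLD.tr (by omega) (br j (i + k) y (br i k x z))

namespace DGLA

/-- The differential as a linear map. -/
def dLin (L : DGLA) (i : ℤ) : L.V i →ₗ[ℂ] L.V (i + 1) :=
  { toFun := L.d i, map_add' := L.d_add i, map_smul' := L.d_smul i }

/-- The bracket as a bilinear map. -/
def brLin (L : DGLA) (i j : ℤ) : L.V i →ₗ[ℂ] L.V j →ₗ[ℂ] L.V (i + j) :=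
  LinearMap.mk₂ ℂ (L.br i j) (L.br_add_left i j) (fun c x y => L.br_smul_left i j c x y)
    (L.br_add_right i j) (fun c x y => L.br_smul_right i j c x y)

end DGLA

/-- Morphism of (differential) graded Lie algebras (data-level). -/
structure GLDHom (L M : GLD) where
  f : ∀ i, L.V i → M.V i
  f_add : ∀ i (x y : L.V i), f i (x + y) = f i x + f i y
  f_smul : ∀ i (c : ℂ) (x : L.V i), f i (c • x) = c • f i x
  f_d : ∀ i (x : L.V i), f (i + 1) (L.d i x) = M.d i (f i x)
  f_br : ∀ i j (x : L.V i) (y : L.V j), f (i + j) (L.br i j x y) = M.br i j (f i x) (f j y)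

/-- The components of a morphism as linear maps. -/
def GLDHom.lin {L M : GLD} (h : GLDHom L M) (i : ℤ) : L.V i →ₗ[ℂ] M.V i :=
  { toFun := h.f i, map_add' := h.f_add i, map_smul' := h.f_smul i }

section ArtinBase

variable (A : Type) [CommRing A] [Algebra ℂ A] [IsLocalRing A]

/-- The maximal ideal of a local `ℂ`-algebra. -/
abbrev mA : Ideal A := IsLocalRing.maximalIdeal A

/-- Multiplication of the maximal ideal, as a `ℂ`-bilinear map. -/
def mMul : (mA A) →ₗ[ℂ] (mA A) →ₗ[ℂ] (mA A) :=
  LinearMap.mk₂ ℂ (fun x y => ⟨x.1 * y.1, Ideal.mul_mem_left _ _ y.2⟩)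
    (fun x x' y => by ext; simp [add_mul])
    (fun c x y => by ext; simp [smul_mul_assoc])
    (fun x y y' => by ext; simp [mul_add])
    (fun c x y => by ext; simp [mul_smul_comm])

/-- For a DGLA `L`, the graded Lie data on `L ⊗ m_A`. -/
def DGLA.ten (L : DGLA) : GLD where
  V i := L.V i ⊗[ℂ] (mA A)
  d i := fun x => LinearMap.rTensor (mA A) (L.dLin i) x
  br i j := fun x y =>
    TensorProduct.curry
      ((TensorProduct.map (TensorProduct.lift (L.brLin i j)) (TensorProduct.lift (mMul A)))
        ∘ₗ (TensorProduct.tensorTensorTensorComm ℂ (L.V i) (mA A) (L.V j) (mA A)).toLinearMap)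
      x y

end ArtinBase
namespace GLD

/-- Polynomial differential forms `W[t,dt]`:
in degree `n` an element is `(p, q)` representing `Σᵢ pᵢ tⁱ + Σᵢ qᵢ tⁱ dt`,
with `pᵢ ∈ W^n` and `qᵢ ∈ W^{n-1}`. -/
def tdt (W : GLD) : GLD where
  V n := (ℕ →₀ W.V n) × (ℕ →₀ W.V (n - 1))
  d n x :=
    (x.1.sum fun i v => Finsupp.single i (W.d n v),
      (x.2.sum fun i v => Finsupp.single i (W.tr (by omega) (W.d (n - 1) v))) +
        ((Int.negOnePow n : ℤˣ) : ℤ) •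
          x.1.sum fun i v => Finsupp.single (i - 1) ((i : ℂ) • W.tr (by omega) v))
  br n m x y :=
    (x.1.sum fun i v => y.1.sum fun j w => Finsupp.single (i + j) (W.br n m v w),
      (x.1.sum fun i v => y.2.sum fun j w =>
          Finsupp.single (i + j) (W.tr (by omega) (W.br n (m - 1) v w))) +
        ((Int.negOnePow m : ℤˣ) : ℤ) •
          x.2.sum fun i v => y.1.sum fun j w =>
            Finsupp.single (i + j) (W.tr (by omega) (W.br (n - 1) m v w)))

/-- Evaluation `e_a : W[t,dt] → W` at a point `a ∈ ℂ`. -/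
def evalT (W : GLD) (a : ℂ) (n : ℤ) (x : (W.tdt).V n) : W.V n :=
  x.1.sum fun i v => (a ^ i) • v

/-- The inclusion `W → W[t,dt]` of constant polynomials. -/
def constT (W : GLD) (n : ℤ) (v : W.V n) : (W.tdt).V n :=
  (Finsupp.single 0 v, 0)

/-- The integral operator `∫₀¹ : W[t,dt] → W` of degree `-1`. -/
def int01 (W : GLD) (n : ℤ) (x : (W.tdt).V n) : W.V (n - 1) :=
  x.2.sum fun i v => (((i : ℂ) + 1))⁻¹ • v

/-- The integral operator `∫₀ᵗ`, returning the polynomial primitive of the `dt`-part. -/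
def int0t (W : GLD) (n : ℤ) (x : (W.tdt).V n) : ℕ →₀ W.V (n - 1) :=
  x.2.sum fun i v => Finsupp.single (i + 1) ((((i : ℂ) + 1))⁻¹ • v)

/-- The standard homotopy `K(m(t,dt)) = t∫₀¹ m − ∫₀ᵗ m` on `W[t,dt]`, of degree `-1`. -/
def Ktdt (W : GLD) (n : ℤ) (x : (W.tdt).V n) : (W.tdt).V (n - 1) :=
  (Finsupp.single 1 (W.int01 n x) - W.int0t n x, 0)

/-- A degreewise map between graded objects is a quasi-isomorphism: elementwise,
it induces a bijection on cohomology in every degree. -/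
def IsQuasiIso (L M : GLD) (f : ∀ i, L.V i → M.V i) : Prop :=
  ∀ i : ℤ,
    (∀ x : M.V i, M.d i x = 0 →
      ∃ y : L.V i, L.d i y = 0 ∧ ∃ z : M.V (i - 1), x = f i y + M.tr (by omega) (M.d (i - 1) z)) ∧
    (∀ y : L.V i, L.d i y = 0 →
      (∃ z : M.V (i - 1), f i y = M.tr (by omega) (M.d (i - 1) z)) →
      ∃ w : L.V (i - 1), y = L.tr (by omega) (L.d (i - 1) w))

/-- Extension of a degreewise map to polynomial differential forms, coefficientwise. -/
def tdtMap {W W' : GLD} (f : ∀ i, W.V i → W'.V i) (n : ℤ) (x : (W.tdt).V n) : (W'.tdt).V n :=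
  (x.1.sum fun i v => Finsupp.single i (f n v),
   x.2.sum fun i v => Finsupp.single i (f (n - 1) v))

end GLD

section Pair

variable (L M N : DGLA) (h : GLDHom L.toGLD M.toGLD) (g : GLDHom N.toGLD M.toGLD)
variable (A : Type) [CommRing A] [Algebra ℂ A] [IsLocalRing A]

/-- The space of triples `(x, y, p) ∈ (L¹ ⊗ m_A) × (N¹ ⊗ m_A) × (M⁰ ⊗ m_A)`;
the element `p` stands for the exponential `e^p ∈ exp(M⁰ ⊗ m_A)`. -/
abbrev TripleSp := ((L.ten A).V 1) × ((N.ten A).V 1) × ((M.ten A).V 0)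

/-- Extension `h ⊗ id` of a morphism to coefficients in `m_A`. -/
def hTen (i : ℤ) : (L.ten A).V i → (M.ten A).V i :=
  fun x => LinearMap.rTensor (mA A) (h.lin i) x

/-- Extension `g ⊗ id` of a morphism to coefficients in `m_A`. -/
def gTen (i : ℤ) : (N.ten A).V i → (M.ten A).V i :=
  fun x => LinearMap.rTensor (mA A) (g.lin i) x

/-- The Maurer-Cartan set `MC_{(h,g)}(A)`: triples `(x, y, e^p)` with
`dx + ½[x,x] = 0`, `dy + ½[y,y] = 0` and `g(y) = e^p * h(x)`. -/
def MCset : Set (TripleSp L M N A) :=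
  {w | (L.ten A).MC1 w.1 ∧ (N.ten A).MC1 w.2.1 ∧
    gTen M N g A 1 w.2.1 = (M.ten A).gauge w.2.2 (hTen L M h A 1 w.1)}

/-- The gauge relation on `MC_{(h,g)}(A)`: `(x₁,y₁,e^{p₁}) ∼ (x₂,y₂,e^{p₂})` iff there are
`a ∈ L⁰ ⊗ m_A`, `b ∈ N⁰ ⊗ m_A`, `c ∈ M⁻¹ ⊗ m_A` with `x₂ = e^a * x₁`, `y₂ = e^b * y₁` and
`e^{p₂} = e^{g(b)} e^T e^{p₁} e^{−h(a)}`, where `T = dc + [g(y₁), c]` and the products of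
exponentials are computed by the Baker-Campbell-Hausdorff formula. -/
def gaugeRel (w w' : TripleSp L M N A) : Prop :=
  ∃ (a : (L.ten A).V 0) (b : (N.ten A).V 0) (c : (M.ten A).V (-1)),
    w'.1 = (L.ten A).gauge a w.1 ∧
    w'.2.1 = (N.ten A).gauge b w.2.1 ∧
    w'.2.2 = (M.ten A).bch (gTen M N g A 0 b)
      ((M.ten A).bch
        ((M.ten A).tr (show (-1:ℤ)+1 = 0 by omega) ((M.ten A).d (-1) c) +
          (M.ten A).tr (show (1:ℤ)+(-1) = 0 by omega)
            ((M.ten A).br 1 (-1) (gTen M N g A 1 w.2.1) c))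
        ((M.ten A).bch w.2.2 (- hTen L M h A 0 a)))

end Pair

open Polynomial in
/-- The exponential series truncated below degree `N`. -/
def expPoly (N : ℕ) : ℂ[X] := ∑ i ∈ Finset.range N, C ((i.factorial : ℂ)⁻¹) * X ^ i

open Polynomial in
/-- The series of `log (1 + X)` truncated below degree `N`. -/
def logPoly (N : ℕ) : ℂ[X] :=
  ∑ i ∈ Finset.range N, C ((-1 : ℂ) ^ (i - 1) / (i : ℂ)) * X ^ i

section TruncatedSeries

open Polynomial

theorem expPoly_succ (n : ℕ) :
    expPoly (n + 1) = expPoly n + C ((n.factorial : ℂ)⁻¹) * X ^ n :=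
  Finset.sum_range_succ _ _

theorem derivative_expPoly_succ (n : ℕ) : derivative (expPoly (n + 1)) = expPoly n := by
  rw [expPoly, expPoly, Finset.sum_range_succ', derivative_add, derivative_sum]
  simp only [pow_zero, mul_one, derivative_C, add_zero]
  refine Finset.sum_congr rfl fun i _ => ?_
  rw [derivative_C_mul_X_pow, Nat.add_sub_cancel]
  congr 2
  rw [Nat.factorial_succ]
  have h1 : (i.factorial : ℂ) ≠ 0 := by exact_mod_cast i.factorial_ne_zero
  have h2 : ((i : ℂ) + 1) ≠ 0 := by exact_mod_cast i.succ_ne_zero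
  push_cast
  field_simp

theorem expPoly_coeff_zero (n : ℕ) : (expPoly (n + 1)).coeff 0 = 1 := by
  rw [expPoly, Finset.sum_range_succ']
  simp

theorem X_dvd_logPoly (n : ℕ) : X ∣ logPoly n := by
  refine Finset.dvd_sum fun i _ => ?_
  rcases i with _ | i
  · simp
  · exact Dvd.dvd.mul_left (dvd_pow_self _ (Nat.succ_ne_zero i)) _

theorem derivative_logPoly_succ_mul (n : ℕ) :
    derivative (logPoly (n + 1)) * (1 + X) = 1 - (-X) ^ n := by
  have h : derivative (logPoly (n + 1)) = ∑ i ∈ Finset.range n, (-X : ℂ[X]) ^ i := by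
    rw [logPoly, Finset.sum_range_succ', derivative_add, derivative_sum]
    simp only [pow_zero, mul_one, derivative_C, add_zero]
    refine Finset.sum_congr rfl fun i _ => ?_
    rw [derivative_C_mul_X_pow, Nat.add_sub_cancel, neg_pow (X : ℂ[X])]
    have h2 : ((i : ℂ) + 1) ≠ 0 := by exact_mod_cast i.succ_ne_zero
    congr 1
    push_cast
    rw [div_mul_cancel₀ _ h2]
    simp
  have := geom_sum_mul (-X : ℂ[X]) n
  rw [h]
  linear_combination -this

theorem X_pow_succ_dvd_of_derivative {n : ℕ} {f : ℂ[X]} (h0 : f.coeff 0 = 0)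
    (h : X ^ n ∣ derivative f) : X ^ (n + 1) ∣ f := by
  rw [X_pow_dvd_iff] at h ⊢
  rintro (_ | k) hk
  · exact h0
  · have h1 := h k (by omega)
    rw [coeff_derivative] at h1
    have h2 : ((k : ℂ) + 1) ≠ 0 := by exact_mod_cast k.succ_ne_zero
    exact (mul_eq_zero.1 h1).resolve_right h2

theorem X_dvd_expPoly_sub_one (n : ℕ) : X ∣ expPoly (n + 1) - 1 := by
  rw [X_dvd_iff]
  simp [expPoly_coeff_zero]

theorem X_pow_dvd_logPoly_comp (n : ℕ) :
    X ^ (n + 1) ∣ (logPoly (n + 1)).comp (expPoly (n + 1) - 1) - X := by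
  set W := expPoly (n + 1) - 1 with hW
  have hXW : X ∣ W := X_dvd_expPoly_sub_one n
  apply X_pow_succ_dvd_of_derivative
  · rw [← X_dvd_iff]
    refine dvd_sub (hXW.trans ?_) dvd_rfl
    obtain ⟨q, hq⟩ := X_dvd_logPoly (n + 1)
    exact ⟨q.comp W, by rw [hq, mul_comp, X_comp]⟩
  · have hcop : IsCoprime (X ^ n : ℂ[X]) (expPoly (n + 1)) := by
      apply IsCoprime.pow_left
      obtain ⟨q, hq⟩ := hXW
      exact ⟨-q, 1, by linear_combination hq - hW⟩
    apply hcop.dvd_of_dvd_mul_left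
    have hd := congrArg (fun p => p.comp W) (derivative_logPoly_succ_mul n)
    simp only [mul_comp, add_comp, one_comp, X_comp, sub_comp, pow_comp, neg_comp] at hd
    have hWd : derivative W = expPoly n := by
      rw [hW, derivative_sub, derivative_expPoly_succ, derivative_one, sub_zero]
    have key : expPoly (n + 1) * derivative ((logPoly (n + 1)).comp W - X) =
        -((-W) ^ n * expPoly n) - C ((n.factorial : ℂ)⁻¹) * X ^ n := by
      rw [derivative_sub, derivative_comp, derivative_X, hWd]
      have hs := expPoly_succ n
      linear_combination expPoly n * hd - hs -
        expPoly n * (derivative (logPoly (n + 1))).comp W * hW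
    rw [key]
    refine dvd_sub ((dvd_neg.2 (Dvd.dvd.mul_right ?_ _))) (dvd_mul_left _ _)
    exact pow_dvd_pow_of_dvd ((dvd_neg).2 hXW) n

theorem X_pow_dvd_expPoly_comp (n : ℕ) :
    X ^ (n + 1) ∣ (expPoly (n + 1)).comp (logPoly (n + 1)) - (1 + X) := by
  set Λ := logPoly (n + 1) with hΛ
  have hX : X ∣ Λ := X_dvd_logPoly _
  set g := (expPoly (n + 1)).comp Λ - (1 + X) with hg
  have key : X ^ n ∣ (1 + X) * derivative g - g := by
    have e : (1 + X) * derivative g - g =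
        -((-X) ^ n * (expPoly n).comp Λ) - C ((n.factorial : ℂ)⁻¹) * Λ ^ n := by
      have hd := derivative_logPoly_succ_mul n
      have hs := congrArg (fun p => p.comp Λ) (expPoly_succ n)
      simp only [add_comp, mul_comp, C_comp, pow_comp, X_comp] at hs
      rw [hg, derivative_sub, derivative_comp, derivative_expPoly_succ]
      simp only [derivative_add, derivative_one, derivative_X]
      linear_combination (expPoly n).comp Λ * hd - hs
    rw [e]
    refine dvd_sub (dvd_neg.2 (Dvd.dvd.mul_right ?_ _)) (Dvd.dvd.mul_left ?_ _)
    · exact pow_dvd_pow_of_dvd (dvd_neg.2 dvd_rfl) n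
    · exact pow_dvd_pow_of_dvd hX n
  have h0 : g.coeff 0 = 0 := by
    have h1 : Λ.eval 0 = 0 := by
      rw [← coeff_zero_eq_eval_zero]; exact X_dvd_iff.1 hX
    rw [hg, coeff_zero_eq_eval_zero]
    simp only [eval_sub, eval_comp, h1, eval_add, eval_one, eval_X]
    rw [← coeff_zero_eq_eval_zero, expPoly_coeff_zero]
    ring
  rw [X_pow_dvd_iff] at key ⊢
  intro k
  induction k with
  | zero => exact fun _ => h0
  | succ k ih =>
    intro hk
    have h1 := key k (by omega)
    have h2 := ih (by omega)
    have h3 : ((k : ℂ) + 1) ≠ 0 := by exact_mod_cast k.succ_ne_zero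
    rw [coeff_sub, h2, sub_zero, add_mul, one_mul, coeff_add, coeff_derivative] at h1
    have h4 : (X * derivative g).coeff k = 0 := by
      rcases k with _ | k
      · simp
      · rw [coeff_X_mul, coeff_derivative, h2, zero_mul]
    rw [h4, add_zero] at h1
    exact (mul_eq_zero.1 h1).resolve_right h3

variable {R : Type*} [Ring R] [Algebra ℂ R]

theorem aeval_eq_zero_of_X_pow_dvd {u : R} {n : ℕ} (hu : u ^ n = 0) {p : ℂ[X]}
    (hp : X ^ n ∣ p) : aeval u p = 0 := by
  obtain ⟨q, rfl⟩ := hp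
  simp [hu]

theorem aeval_logPoly_aeval_expPoly {u : R} {n : ℕ} (hu : u ^ (n + 1) = 0) :
    aeval (aeval u (expPoly (n + 1)) - 1) (logPoly (n + 1)) = u := by
  have := aeval_eq_zero_of_X_pow_dvd hu (X_pow_dvd_logPoly_comp n)
  rw [map_sub, aeval_comp, aeval_X, map_sub, map_one, sub_eq_zero] at this
  exact this

theorem aeval_expPoly_aeval_logPoly {u : R} {n : ℕ} (hu : u ^ (n + 1) = 0) :
    aeval (aeval u (logPoly (n + 1))) (expPoly (n + 1)) = 1 + u := by
  have := aeval_eq_zero_of_X_pow_dvd hu (X_pow_dvd_expPoly_comp n)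
  rw [map_sub, aeval_comp, map_add, map_one, aeval_X, sub_eq_zero] at this
  exact this

end TruncatedSeries

/-- The exponential `Σ uⁿ/n!` of a nilpotent element of a complex algebra. -/
def nexp {R : Type*} [Ring R] [Algebra ℂ R] (u : R) : R :=
  ∑ᶠ n : ℕ, ((n.factorial : ℂ))⁻¹ • u ^ n

section NilpotentExp

attribute [local instance] LieRing.ofAssociativeRing

open Polynomial (aeval)

variable {R : Type*} [Ring R] [Algebra ℂ R]

theorem aeval_expPoly (u : R) (n : ℕ) :
    aeval u (expPoly n) = ∑ i ∈ Finset.range n, ((i.factorial : ℂ))⁻¹ • u ^ i := by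
  simp [expPoly, map_sum, Algebra.smul_def]

theorem nexp_eq_sum {u : R} {n : ℕ} (hu : u ^ n = 0) :
    nexp u = ∑ i ∈ Finset.range n, ((i.factorial : ℂ))⁻¹ • u ^ i := by
  refine finsum_eq_sum_of_support_subset _ fun i hi => ?_
  by_contra h
  simp only [Finset.coe_range, Set.mem_Iio, not_lt] at h
  exact hi (by simp [pow_eq_zero_of_le h hu])

theorem nexp_eq_aeval {u : R} {n : ℕ} (hu : u ^ n = 0) : nexp u = aeval u (expPoly n) := by
  rw [nexp_eq_sum hu, aeval_expPoly]

theorem nexp_injective {u v : R} (hu : IsNilpotent u) (hv : IsNilpotent v)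
    (h : nexp u = nexp v) : u = v := by
  obtain ⟨m, hm⟩ := hu
  obtain ⟨n, hn⟩ := hv
  have hm' : u ^ (m + n + 1) = 0 := pow_eq_zero_of_le (by omega) hm
  have hn' : v ^ (m + n + 1) = 0 := pow_eq_zero_of_le (by omega) hn
  rw [← aeval_logPoly_aeval_expPoly hm', ← aeval_logPoly_aeval_expPoly hn',
    ← nexp_eq_aeval hm', ← nexp_eq_aeval hn', h]

theorem nexp_eq_exp [Module ℚ R] {u : R} (hu : IsNilpotent u) : nexp u = IsNilpotent.exp u := by
  obtain ⟨n, hn⟩ := hu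
  rw [nexp_eq_sum hn, IsNilpotent.exp_eq_sum hn]
  refine Finset.sum_congr rfl fun i _ => ?_
  have h0 : (i.factorial : ℂ) ≠ 0 := by exact_mod_cast i.factorial_ne_zero
  rw [inv_smul_eq_iff₀ h0, Nat.cast_smul_eq_nsmul, ← Nat.cast_smul_eq_nsmul ℚ, smul_smul,
    mul_inv_cancel₀ (by exact_mod_cast i.factorial_ne_zero), one_smul]

theorem nexp_add_of_commute {u v : R} (h : Commute u v) (hu : IsNilpotent u)
    (hv : IsNilpotent v) : nexp (u + v) = nexp u * nexp v := by
  let _ : Module ℚ R := Module.compHom R (algebraMap ℚ ℂ)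
  rw [nexp_eq_exp hu, nexp_eq_exp hv, nexp_eq_exp (h.isNilpotent_add hu hv),
    IsNilpotent.exp_add_of_commute h hu hv]

theorem nexp_zero : nexp (0 : R) = 1 := by
  rw [nexp_eq_sum (pow_one 0)]
  simp

theorem nexp_mul_nexp_neg {u : R} (hu : IsNilpotent u) : nexp u * nexp (-u) = 1 := by
  rw [← nexp_add_of_commute (Commute.neg_right rfl) hu hu.neg, add_neg_cancel, nexp_zero]

theorem nexp_neg_mul_nexp {u : R} (hu : IsNilpotent u) : nexp (-u) * nexp u = 1 := by
  rw [← nexp_add_of_commute (Commute.neg_left rfl) hu.neg hu, neg_add_cancel, nexp_zero]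

theorem map_nexp {S : Type*} [Ring S] [Algebra ℂ S] (f : R →ₐ[ℂ] S) {u : R}
    (hu : IsNilpotent u) : f (nexp u) = nexp (f u) := by
  obtain ⟨n, hn⟩ := hu
  have hn' : f u ^ n = 0 := by rw [← map_pow, hn, map_zero]
  simp [nexp_eq_sum hn, nexp_eq_sum hn', map_sum]

variable {V W : Type*} [AddCommGroup V] [Module ℂ V] [AddCommGroup W] [Module ℂ W]

theorem nexp_apply_of_intertwine {P : Module.End ℂ V} {S : Module.End ℂ W}
    (hP : IsNilpotent P) (hS : IsNilpotent S) (f : V →ₗ[ℂ] W)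
    (hf : ∀ v, S (f v) = f (P v)) (v : V) : nexp S (f v) = f (nexp P v) := by
  obtain ⟨m, hm⟩ := hP
  obtain ⟨n, hn⟩ := hS
  have hm' : P ^ (m + n) = 0 := pow_eq_zero_of_le (by omega) hm
  have hn' : S ^ (m + n) = 0 := pow_eq_zero_of_le (by omega) hn
  have hpow : ∀ (i : ℕ) (v : V), (S ^ i) (f v) = f ((P ^ i) v) := by
    intro i
    induction i with
    | zero => intro v; rfl
    | succ i ih => intro v; rw [pow_succ, pow_succ, Module.End.mul_apply, hf, ih]; rfl
  simp [nexp_eq_sum hm', nexp_eq_sum hn', LinearMap.sum_apply, hpow]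

theorem nexp_apply_of_bilinear {U : Type*} [AddCommGroup U] [Module ℂ U]
    {P : Module.End ℂ V} {Q : Module.End ℂ W} {S : Module.End ℂ U}
    (hP : IsNilpotent P) (hQ : IsNilpotent Q) (hS : IsNilpotent S)
    (β : V →ₗ[ℂ] W →ₗ[ℂ] U) (hβ : ∀ v w, S (β v w) = β (P v) w + β v (Q w)) (v : V) (w : W) :
    nexp S (β v w) = β (nexp P v) (nexp Q w) := by
  let PT : Module.End ℂ (V ⊗[ℂ] W) := P.rTensor W
  let QT : Module.End ℂ (V ⊗[ℂ] W) := Q.lTensor V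
  have hPT : IsNilpotent PT := hP.map <| Module.End.rTensorAlgHom ℂ V W
  have hQT : IsNilpotent QT := hQ.map <| Module.End.lTensorAlgHom ℂ W V
  have hc : Commute PT QT := by
    refine TensorProduct.ext' fun v w => ?_
    simp [PT, QT]
  have h1 : nexp PT = (nexp P).rTensor W := (map_nexp (Module.End.rTensorAlgHom ℂ V W) hP).symm
  have h2 : nexp QT = (nexp Q).lTensor V := (map_nexp (Module.End.lTensorAlgHom ℂ W V) hQ).symm
  have h3 := nexp_apply_of_intertwine (hc.isNilpotent_add hPT hQT) hS (TensorProduct.lift β)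
    (fun t => by
      induction t with
      | zero => simp
      | tmul v w => simp [PT, QT, hβ]
      | add a b ha hb => simp only [map_add, ha, hb]) (v ⊗ₜ w)
  rw [nexp_add_of_commute hc hPT hQT, h1, h2] at h3
  simpa using h3

theorem isNilpotent_mulLeft {u : R} (hu : IsNilpotent u) :
    IsNilpotent (LinearMap.mulLeft ℂ u) := by
  obtain ⟨n, hn⟩ := hu
  exact ⟨n, by rw [LinearMap.pow_mulLeft, hn, LinearMap.mulLeft_zero_eq_zero]⟩

theorem isNilpotent_mulRight {u : R} (hu : IsNilpotent u) :
    IsNilpotent (LinearMap.mulRight ℂ u) := by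
  obtain ⟨n, hn⟩ := hu
  exact ⟨n, by rw [LinearMap.pow_mulRight, hn, LinearMap.mulRight_zero_eq_zero]⟩

theorem nexp_mulLeft {u : R} (hu : IsNilpotent u) :
    nexp (LinearMap.mulLeft ℂ u) = LinearMap.mulLeft ℂ (nexp u) :=
  (map_nexp (Algebra.lmul ℂ R) hu).symm

theorem nexp_mulRight {u : R} (hu : IsNilpotent u) :
    nexp (LinearMap.mulRight ℂ u) = LinearMap.mulRight ℂ (nexp u) := by
  obtain ⟨n, hn⟩ := hu
  have hn' : LinearMap.mulRight ℂ u ^ n = 0 := by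
    rw [LinearMap.pow_mulRight, hn, LinearMap.mulRight_zero_eq_zero]
  ext x
  simp [nexp_eq_sum hn, nexp_eq_sum hn', LinearMap.pow_mulRight, LinearMap.sum_apply,
    Finset.mul_sum]

theorem ad_eq_mulLeft_add_mulRight (u : R) :
    LieAlgebra.ad ℂ R u = LinearMap.mulLeft ℂ u + LinearMap.mulRight ℂ (-u) := by
  ext x
  simp [Ring.lie_def, sub_eq_add_neg]

theorem commute_mulLeft_mulRight (u v : R) :
    Commute (LinearMap.mulLeft ℂ u) (LinearMap.mulRight ℂ v) := by
  ext x
  simp [mul_assoc]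

theorem isNilpotent_ad {u : R} (hu : IsNilpotent u) : IsNilpotent (LieAlgebra.ad ℂ R u) := by
  rw [ad_eq_mulLeft_add_mulRight]
  exact (commute_mulLeft_mulRight u (-u)).isNilpotent_add (isNilpotent_mulLeft hu)
    (isNilpotent_mulRight hu.neg)

theorem nexp_ad {u : R} (hu : IsNilpotent u) :
    nexp (LieAlgebra.ad ℂ R u) =
      LinearMap.mulLeft ℂ (nexp u) * LinearMap.mulRight ℂ (nexp (-u)) := by
  rw [ad_eq_mulLeft_add_mulRight, nexp_add_of_commute (commute_mulLeft_mulRight u (-u))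
    (isNilpotent_mulLeft hu) (isNilpotent_mulRight hu.neg), nexp_mulLeft hu,
    nexp_mulRight hu.neg]

theorem nexp_ad_apply {u : R} (hu : IsNilpotent u) (x : R) :
    nexp (LieAlgebra.ad ℂ R u) x = nexp u * x * nexp (-u) := by
  rw [nexp_ad hu]
  simp [mul_assoc]

/-- If `e^z = e^u e^v`, then `e^{ad z} = e^{ad u} e^{ad v}`. -/
theorem nexp_ad_of_nexp_eq_mul {u v z : R} (hu : IsNilpotent u) (hv : IsNilpotent v)
    (hz : IsNilpotent z) (h : nexp z = nexp u * nexp v) :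
    nexp (LieAlgebra.ad ℂ R z) = nexp (LieAlgebra.ad ℂ R u) * nexp (LieAlgebra.ad ℂ R v) := by
  have h' : nexp (-z) = nexp (-v) * nexp (-u) := by
    refine left_inv_eq_right_inv (nexp_neg_mul_nexp hz) ?_
    rw [h, mul_assoc, ← mul_assoc (nexp v), nexp_mul_nexp_neg hv, one_mul, nexp_mul_nexp_neg hu]
  ext x
  simp only [Module.End.mul_apply, nexp_ad_apply hu, nexp_ad_apply hv, nexp_ad_apply hz, h, h',
    mul_assoc]

/-- The conjugate of `e^x` by `e^u` is the exponential of `e^{ad u} x`. -/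
theorem nexp_nexp_ad_apply {u x : R} (hu : IsNilpotent u) (hx : IsNilpotent x) :
    nexp (nexp (LieAlgebra.ad ℂ R u) x) = nexp u * nexp x * nexp (-u) := by
  have h1 := nexp_mul_nexp_neg hu
  have h2 := nexp_neg_mul_nexp hu
  rw [nexp_ad_apply hu]
  have hpow : ∀ i : ℕ, (nexp u * x * nexp (-u)) ^ i = nexp u * x ^ i * nexp (-u) := by
    intro i
    induction i with
    | zero => simp [h1]
    | succ i ih =>
      rw [pow_succ, ih, pow_succ]
      calc nexp u * x ^ i * nexp (-u) * (nexp u * x * nexp (-u))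
          = nexp u * x ^ i * (nexp (-u) * nexp u) * x * nexp (-u) := by simp only [mul_assoc]
        _ = _ := by rw [h2]; simp only [mul_assoc, one_mul]
  obtain ⟨n, hn⟩ := hx
  have hn' : (nexp u * x * nexp (-u)) ^ n = 0 := by rw [hpow, hn, mul_zero, zero_mul]
  rw [nexp_eq_sum hn', nexp_eq_sum hn, Finset.mul_sum, Finset.sum_mul]
  refine Finset.sum_congr rfl fun i _ => ?_
  rw [hpow, mul_smul_comm, smul_mul_assoc]

end NilpotentExp

/-- All products of at least `n` elements of `s` vanish. -/
def ProductsVanish {R : Type*} [Ring R] (s : Set R) (n : ℕ) : Prop :=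
  ∀ l : List R, (∀ u ∈ l, u ∈ s) → n ≤ l.length → l.prod = 0

/-- The value of a word in the letters `a` (true) and `b` (false) in a monoid. -/
def wordProd {R : Type*} [Monoid R] (a b : R) (w : List Bool) : R :=
  (w.map fun c => if c then a else b).prod

/-- The lists of length `n` with entries in `S`. -/
def listsOfLength {α : Type*} [DecidableEq α] (S : Finset α) : ℕ → Finset (List α)
  | 0 => {[]}
  | n + 1 => (S ×ˢ listsOfLength S n).image fun p => p.1 :: p.2

/-- The pairs of exponents, not both zero and both less than `N`. -/
def exponentPairs (N : ℕ) : Finset (ℕ × ℕ) :=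
  (Finset.range N ×ˢ Finset.range N).erase (0, 0)

/-- The lists of fewer than `N` nonzero pairs of exponents less than `N`. -/
def dynkinLists (N : ℕ) : Finset (List (ℕ × ℕ)) :=
  (Finset.range N).biUnion (listsOfLength (exponentPairs N))

/-- The coefficient of the product of a word in the expansion of `log (e^a e^b)`. -/
def logCoeff (P : List (ℕ × ℕ)) : ℂ :=
  (-1 : ℂ) ^ (P.length - 1) / (P.length : ℂ) *
    (P.map fun p => ((p.1.factorial : ℂ) * (p.2.factorial : ℂ))⁻¹).prod

section Words

theorem mem_listsOfLength {α : Type*} [DecidableEq α] {S : Finset α} {n : ℕ} {l : List α} :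
    l ∈ listsOfLength S n ↔ l.length = n ∧ ∀ p ∈ l, p ∈ S := by
  induction n generalizing l with
  | zero =>
    simp only [listsOfLength, Finset.mem_singleton, List.length_eq_zero_iff]
    exact ⟨by rintro rfl; simp, fun h => h.1⟩
  | succ n ih =>
    rcases l with _ | ⟨p, l⟩
    · simp [listsOfLength]
    · simp [listsOfLength, ih]
      tauto

theorem sum_pow_eq_sum_listsOfLength {α : Type*} [DecidableEq α] {R : Type*} [Semiring R]
    (S : Finset α) (f : α → R) (n : ℕ) :
    (∑ s ∈ S, f s) ^ n = ∑ l ∈ listsOfLength S n, (l.map f).prod := by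
  induction n with
  | zero => simp [listsOfLength]
  | succ n ih =>
    rw [pow_succ', ih, listsOfLength, Finset.sum_image, Finset.sum_mul_sum,
      Finset.sum_product]
    · simp
    · rintro ⟨p, l⟩ - ⟨p', l'⟩ - h
      simpa using h

theorem sum_dynkinLists {M : Type*} [AddCommMonoid M] (N : ℕ) (f : List (ℕ × ℕ) → M) :
    ∑ P ∈ dynkinLists N, f P =
      ∑ i ∈ Finset.range N, ∑ P ∈ listsOfLength (exponentPairs N) i, f P := by
  refine Finset.sum_biUnion fun i _ j _ hij => ?_
  rw [Function.onFun, Finset.disjoint_left]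
  intro P hi hj
  exact hij ((mem_listsOfLength.1 hi).1.symm.trans (mem_listsOfLength.1 hj).1)

theorem bchWord_nil : bchWord [] = [] := rfl

theorem bchWord_cons (p : ℕ × ℕ) (P : List (ℕ × ℕ)) :
    bchWord (p :: P) =
      (List.replicate p.1 true ++ List.replicate p.2 false) ++ bchWord P := rfl

theorem length_bchWord (P : List (ℕ × ℕ)) :
    (bchWord P).length = (P.map fun p => p.1 + p.2).sum := by
  induction P with
  | nil => rfl
  | cons p P ih =>
    rw [bchWord_cons, List.length_append, ih, List.map_cons, List.sum_cons]
    simp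

theorem length_le_length_bchWord {P : List (ℕ × ℕ)} (hP : ∀ p ∈ P, 0 < p.1 + p.2) :
    P.length ≤ (bchWord P).length := by
  induction P with
  | nil => simp
  | cons p P ih =>
    have h1 := ih fun q hq => hP q (List.mem_cons_of_mem _ hq)
    have h2 := hP p List.mem_cons_self
    simp [bchWord_cons]
    omega

theorem add_le_length_bchWord {P : List (ℕ × ℕ)} {p : ℕ × ℕ} (hp : p ∈ P) :
    p.1 + p.2 ≤ (bchWord P).length := by
  rw [length_bchWord]
  exact List.single_le_sum (by simp) _ (List.mem_map_of_mem hp)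

theorem mem_exponentPairs {N : ℕ} {p : ℕ × ℕ} :
    p ∈ exponentPairs N ↔ 0 < p.1 + p.2 ∧ p.1 < N ∧ p.2 < N := by
  obtain ⟨r, s⟩ := p
  simp [exponentPairs]
  omega

theorem mem_dynkinLists {N : ℕ} {P : List (ℕ × ℕ)} :
    P ∈ dynkinLists N ↔
      P.length < N ∧ ∀ p ∈ P, 0 < p.1 + p.2 ∧ p.1 < N ∧ p.2 < N := by
  simp [dynkinLists, mem_listsOfLength, mem_exponentPairs]

theorem logCoeff_nil : logCoeff [] = 0 := by simp [logCoeff]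

theorem bchCoeff_mul_length {N : ℕ} {P : List (ℕ × ℕ)} (hP : P ∈ dynkinLists N) :
    bchCoeff P * ((bchWord P).length : ℂ) = logCoeff P := by
  rw [mem_dynkinLists] at hP
  by_cases h0 : P = []
  · simp [h0, logCoeff_nil, bchCoeff]
  have hpos : ∀ p ∈ P, 0 < p.1 + p.2 := fun p hp => (hP.2 p hp).1
  have hlen : ((bchWord P).length : ℂ) ≠ 0 := by
    have h1 := length_le_length_bchWord hpos
    have h2 := List.length_pos_iff.2 h0
    exact_mod_cast (by omega : (bchWord P).length ≠ 0)
  have hprod : (P.map fun p => ((p.1.factorial : ℂ) * (p.2.factorial : ℂ))⁻¹).prod =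
      (((P.map fun p => (p.1.factorial * p.2.factorial : ℕ)).prod : ℕ) : ℂ)⁻¹ := by
    clear hP h0 hpos hlen
    induction P with
    | nil => simp
    | cons p P ih =>
      rw [List.map_cons, List.prod_cons, ih, List.map_cons, List.prod_cons, Nat.cast_mul,
        Nat.cast_mul, mul_inv, mul_inv, mul_inv]
  rw [bchCoeff, if_neg (by push Not; exact ⟨h0, hpos⟩), logCoeff, hprod, ← length_bchWord,
    mul_inv]
  field_simp

theorem bchCoeff_eq_zero {N : ℕ} {P : List (ℕ × ℕ)} (hP : P ∉ dynkinLists N)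
    (hN : (bchWord P).length < N) : bchCoeff P = 0 := by
  by_contra h
  apply hP
  rw [bchCoeff] at h
  have h1 : ¬ (P = [] ∨ ¬ (∀ p ∈ P, 0 < p.1 + p.2)) := fun h' => h (if_pos h')
  push Not at h1
  rw [mem_dynkinLists]
  refine ⟨(length_le_length_bchWord h1.2).trans_lt hN, fun p hp => ⟨h1.2 p hp, ?_⟩⟩
  have := add_le_length_bchWord hp
  omega

theorem bchWord_ne_nil {N : ℕ} {P : List (ℕ × ℕ)} (hP : P ∈ dynkinLists N) (h : P ≠ []) :
    bchWord P ≠ [] := by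
  rw [mem_dynkinLists] at hP
  have h1 := length_le_length_bchWord fun p hp => (hP.2 p hp).1
  have h2 := List.length_pos_iff.2 h
  exact List.length_pos_iff.1 (by omega)

variable {R : Type*} [Ring R]

theorem wordProd_append (a b : R) (v w : List Bool) :
    wordProd a b (v ++ w) = wordProd a b v * wordProd a b w := by
  simp [wordProd]

theorem wordProd_bchWord_cons (a b : R) (p : ℕ × ℕ) (P : List (ℕ × ℕ)) :
    wordProd a b (bchWord (p :: P)) = a ^ p.1 * b ^ p.2 * wordProd a b (bchWord P) := by
  rw [bchWord_cons, wordProd_append, wordProd_append]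
  simp [wordProd]

theorem wordProd_eq_zero {a b : R} {n : ℕ} (h : ProductsVanish {a, b} n) {w : List Bool}
    (hw : n ≤ w.length) : wordProd a b w = 0 := by
  refine h _ ?_ (by simpa using hw)
  intro u hu
  obtain ⟨c, -, rfl⟩ := List.mem_map.1 hu
  cases c <;> simp

theorem ProductsVanish.mono {s : Set R} {m n : ℕ} (h : ProductsVanish s m) (hmn : m ≤ n) :
    ProductsVanish s n := fun l hl hn => h l hl (hmn.trans hn)

theorem ProductsVanish.pow_eq_zero {s : Set R} {n : ℕ} (h : ProductsVanish s n) {u : R}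
    (hu : u ∈ s) : u ^ n = 0 := by
  rw [← List.prod_replicate]
  exact h _ (fun v hv => (List.eq_of_mem_replicate hv) ▸ hu) (by simp)

theorem ProductsVanish.isNilpotent {s : Set R} {n : ℕ} (h : ProductsVanish s n) {u : R}
    (hu : u ∈ s) : IsNilpotent u := ⟨n, h.pow_eq_zero hu⟩

theorem ProductsVanish.monomial_one {s : Set R} {n : ℕ} (h : ProductsVanish s n) :
    ProductsVanish ((fun r : R => Polynomial.monomial 1 r) '' s) n := by
  have key : ∀ l : List (Polynomial R), (∀ u ∈ l, u ∈ (fun r : R => Polynomial.monomial 1 r) '' s) →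
      ∃ l' : List R, (∀ u ∈ l', u ∈ s) ∧ l'.length = l.length ∧
        l.prod = Polynomial.monomial l.length l'.prod := by
    intro l
    induction l with
    | nil => intro _; exact ⟨[], by simp, rfl, by simp⟩
    | cons u l ih =>
      intro hl
      obtain ⟨l', h1, h2, h3⟩ := ih fun v hv => hl v (List.mem_cons_of_mem _ hv)
      obtain ⟨r, hr, rfl⟩ := hl u List.mem_cons_self
      refine ⟨r :: l', ?_, by simp [h2], ?_⟩
      · simpa using ⟨hr, h1⟩
      · rw [List.prod_cons, h3, Polynomial.monomial_mul_monomial, List.prod_cons,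
          List.length_cons, add_comm]
  intro l hl hn
  obtain ⟨l', h1, h2, h3⟩ := key l hl
  rw [h3, h l' h1 (by omega), map_zero]

theorem ProductsVanish.map {S : Type*} [Ring S] {F : Type*} [FunLike F R S]
    [RingHomClass F R S] (f : F) {s : Set R} {n : ℕ} (h : ProductsVanish s n) :
    ProductsVanish (f '' s) n := by
  intro l hl hn
  obtain ⟨l', rfl⟩ : ∃ l' : List {r // r ∈ s}, l'.map (fun r => f r.1) = l := by
    clear hn
    induction l with
    | nil => exact ⟨[], rfl⟩
    | cons u l ih =>
      obtain ⟨l', rfl⟩ := ih fun v hv => hl v (List.mem_cons_of_mem _ hv)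
      obtain ⟨r, hr, rfl⟩ := hl u List.mem_cons_self
      exact ⟨⟨r, hr⟩ :: l', rfl⟩
  have := h (l'.map Subtype.val) (by simpa using fun _ h _ => h) (by simpa using hn)
  rw [← Function.comp_def f Subtype.val, ← List.map_map, ← map_list_prod, this, map_zero]

end Words

section LogOfProduct

open Polynomial (aeval)

variable {R : Type*} [Ring R] [Algebra ℂ R]

/-- The truncated expansion of `log (e^a e^b)` as a combination of words. -/
def logWordSum (a b : R) (N : ℕ) : R :=
  ∑ P ∈ dynkinLists N, logCoeff P • wordProd a b (bchWord P)

theorem prod_map_smul_pow_mul_pow (a b : R) (P : List (ℕ × ℕ)) :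
    (P.map fun p => ((p.1.factorial : ℂ) * (p.2.factorial : ℂ))⁻¹ • (a ^ p.1 * b ^ p.2)).prod =
      (P.map fun p => ((p.1.factorial : ℂ) * (p.2.factorial : ℂ))⁻¹).prod •
        wordProd a b (bchWord P) := by
  induction P with
  | nil => simp [bchWord_nil, wordProd]
  | cons p P ih =>
    rw [List.map_cons, List.prod_cons, ih, List.map_cons, List.prod_cons, wordProd_bchWord_cons,
      smul_mul_assoc, mul_smul_comm, smul_smul]

theorem nexp_mul_nexp_sub_one {a b : R} {n : ℕ} (ha : a ^ (n + 1) = 0) (hb : b ^ (n + 1) = 0) :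
    nexp a * nexp b - 1 = ∑ p ∈ exponentPairs (n + 1),
      ((p.1.factorial : ℂ) * (p.2.factorial : ℂ))⁻¹ • (a ^ p.1 * b ^ p.2) := by
  rw [exponentPairs, Finset.sum_erase_eq_sub (by simp), nexp_eq_sum ha, nexp_eq_sum hb,
    Finset.sum_mul_sum, Finset.sum_product]
  congr 1
  · refine Finset.sum_congr rfl fun i _ => Finset.sum_congr rfl fun j _ => ?_
    rw [smul_mul_assoc, mul_smul_comm, smul_smul, mul_inv]
  · simp

theorem pow_nexp_mul_nexp_sub_one {a b : R} {n : ℕ} (ha : a ^ (n + 1) = 0)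
    (hb : b ^ (n + 1) = 0) (k : ℕ) :
    (nexp a * nexp b - 1) ^ k = ∑ P ∈ listsOfLength (exponentPairs (n + 1)) k,
      (P.map fun p => ((p.1.factorial : ℂ) * (p.2.factorial : ℂ))⁻¹).prod •
        wordProd a b (bchWord P) := by
  rw [nexp_mul_nexp_sub_one ha hb, sum_pow_eq_sum_listsOfLength]
  exact Finset.sum_congr rfl fun P _ => prod_map_smul_pow_mul_pow a b P

theorem aeval_logPoly_nexp_mul_nexp {a b : R} {n : ℕ} (ha : a ^ (n + 1) = 0)
    (hb : b ^ (n + 1) = 0) :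
    aeval (nexp a * nexp b - 1) (logPoly (n + 1)) = logWordSum a b (n + 1) := by
  rw [logPoly, map_sum, logWordSum, sum_dynkinLists]
  refine Finset.sum_congr rfl fun i _ => ?_
  rw [map_mul, Polynomial.aeval_C, map_pow, Polynomial.aeval_X, pow_nexp_mul_nexp_sub_one ha hb,
    ← Algebra.smul_def, Finset.smul_sum]
  refine Finset.sum_congr rfl fun P hP => ?_
  rw [smul_smul, logCoeff, (mem_listsOfLength.1 hP).1]

theorem nexp_mul_nexp_sub_one_pow {a b : R} {n : ℕ} (h : ProductsVanish {a, b} (n + 1)) :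
    (nexp a * nexp b - 1) ^ (n + 1) = 0 := by
  rw [pow_nexp_mul_nexp_sub_one (h.pow_eq_zero (by simp)) (h.pow_eq_zero (by simp))]
  refine Finset.sum_eq_zero fun P hP => ?_
  rw [mem_listsOfLength] at hP
  rw [wordProd_eq_zero h, smul_zero]
  rw [← hP.1]
  exact length_le_length_bchWord fun p hp => (mem_exponentPairs.1 (hP.2 p hp)).1

theorem isNilpotent_logWordSum {a b : R} {n : ℕ} (h : ProductsVanish {a, b} (n + 1)) :
    IsNilpotent (logWordSum a b (n + 1)) := by
  refine ⟨n + 1, ?_⟩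
  rw [← aeval_logPoly_nexp_mul_nexp (h.pow_eq_zero (by simp)) (h.pow_eq_zero (by simp)),
    ← map_pow]
  exact aeval_eq_zero_of_X_pow_dvd (nexp_mul_nexp_sub_one_pow h)
    (pow_dvd_pow_of_dvd (X_dvd_logPoly _) _)

theorem nexp_logWordSum {a b : R} {n : ℕ} (h : ProductsVanish {a, b} (n + 1)) :
    nexp (logWordSum a b (n + 1)) = nexp a * nexp b := by
  have h1 := aeval_expPoly_aeval_logPoly (nexp_mul_nexp_sub_one_pow h)
  have h2 := aeval_eq_zero_of_X_pow_dvd (nexp_mul_nexp_sub_one_pow h)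
    (pow_dvd_pow_of_dvd (X_dvd_logPoly (n + 1)) (n + 1))
  rw [map_pow] at h2
  rw [← aeval_logPoly_nexp_mul_nexp (h.pow_eq_zero (by simp)) (h.pow_eq_zero (by simp)),
    nexp_eq_aeval h2, h1]
  abel

theorem eq_logWordSum_of_nexp_eq {a b z : R} {n : ℕ} (h : ProductsVanish {a, b} (n + 1))
    (hz : IsNilpotent z) (he : nexp z = nexp a * nexp b) : z = logWordSum a b (n + 1) :=
  nexp_injective hz (isNilpotent_logWordSum h) (he.trans (nexp_logWordSum h).symm)

end LogOfProduct

/-- Right-nested bracket of a word in two letters `x` (true) and `y` (false) of a Lie ring. -/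
def lnest {𝔤 : Type*} [LieRing 𝔤] (x y : 𝔤) : List Bool → 𝔤
  | [] => 0
  | [b] => if b then x else y
  | b :: (c :: rest) => ⁅if b then x else y, lnest x y (c :: rest)⁆

/-- The Baker-Campbell-Hausdorff product on a complex Lie algebra, via Dynkin's formula. -/
def lbch {𝔤 : Type*} [LieRing 𝔤] [LieAlgebra ℂ 𝔤] (x y : 𝔤) : 𝔤 :=
  ∑ᶠ P : List (ℕ × ℕ), bchCoeff P • lnest x y (bchWord P)

section NestedBrackets

variable {𝔤 : Type*} [LieRing 𝔤]

theorem lnest_cons_cons (x y : 𝔤) (b c : Bool) (w : List Bool) :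
    lnest x y (b :: c :: w) = ⁅if b then x else y, lnest x y (c :: w)⁆ := rfl

theorem lnest_zero (w : List Bool) : lnest (0 : 𝔤) 0 w = 0 := by
  rcases w with _ | ⟨b, _ | ⟨c, w⟩⟩ <;> simp [lnest]

variable [LieAlgebra ℂ 𝔤]

theorem lbch_eq_sum {x y : 𝔤} {N : ℕ} (h : ∀ w : List Bool, N ≤ w.length → lnest x y w = 0) :
    lbch x y = ∑ P ∈ dynkinLists N, bchCoeff P • lnest x y (bchWord P) := by
  refine finsum_eq_sum_of_support_subset _ fun P hP => ?_
  by_contra hmem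
  refine hP ?_
  by_cases hN : (bchWord P).length < N
  · simp [bchCoeff_eq_zero (by simpa using hmem) hN]
  · simp [h _ (not_lt.1 hN)]

variable {𝔥 : Type*} [LieRing 𝔥] [LieAlgebra ℂ 𝔥]

theorem map_lnest (φ : 𝔤 →ₗ⁅ℂ⁆ 𝔥) (x y : 𝔤) (w : List Bool) :
    φ (lnest x y w) = lnest (φ x) (φ y) w := by
  induction w with
  | nil => simp [lnest]
  | cons b w ih =>
    rcases w with _ | ⟨c, w⟩
    · cases b <;> simp [lnest]
    · rw [lnest_cons_cons, lnest_cons_cons, LieHom.map_lie, ih]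
      cases b <;> simp

theorem map_lbch (φ : 𝔤 →ₗ⁅ℂ⁆ 𝔥) {x y : 𝔤} {N : ℕ}
    (h : ∀ w : List Bool, N ≤ w.length → lnest x y w = 0) :
    φ (lbch x y) = lbch (φ x) (φ y) := by
  rw [lbch_eq_sum h, lbch_eq_sum (N := N) fun w hw => by rw [← map_lnest, h w hw, map_zero]]
  simp [map_lnest]

end NestedBrackets

section AssociativeBCH

attribute [local instance] LieRing.ofAssociativeRing

variable {R : Type*} [Ring R] [Algebra ℂ R]

/-- The span of the products `p * t * q` with `p` and `q` products of elements of `s`,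
of total length `k`. -/
def sandwichSpan (s : Set R) (t : R) (k : ℕ) : Submodule ℂ R :=
  Submodule.span ℂ {r | ∃ p q : List R, (∀ u ∈ p, u ∈ s) ∧ (∀ u ∈ q, u ∈ s) ∧
    p.length + q.length = k ∧ r = p.prod * t * q.prod}

theorem lie_mem_sandwichSpan {s : Set R} {t u v : R} {k : ℕ} (hu : u ∈ s)
    (hv : v ∈ sandwichSpan s t k) : ⁅u, v⁆ ∈ sandwichSpan s t (k + 1) := by
  induction hv using Submodule.span_induction with
  | mem v hv =>
    obtain ⟨p, q, hp, hq, hk, rfl⟩ := hv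
    rw [Ring.lie_def]
    refine Submodule.sub_mem _ (Submodule.subset_span ⟨u :: p, q, ?_, hq, ?_, ?_⟩)
      (Submodule.subset_span ⟨p, q ++ [u], hp, ?_, ?_, ?_⟩)
    · simpa using ⟨hu, hp⟩
    · simp; omega
    · simp [mul_assoc]
    · intro v hv
      rcases List.mem_append.1 hv with hv | hv
      · exact hq v hv
      · rw [List.mem_singleton.1 hv]; exact hu
    · simp; omega
    · simp [mul_assoc]
  | zero => simp
  | add v w _ _ hv hw => rw [lie_add]; exact Submodule.add_mem _ hv hw
  | smul c v _ hv => rw [lie_smul]; exact Submodule.smul_mem _ _ hv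

theorem eq_zero_of_mem_sandwichSpan {s : Set R} {n : ℕ} (h : ProductsVanish s n) {t v : R}
    {k : ℕ} (hk : 2 * n ≤ k) (hv : v ∈ sandwichSpan s t k) : v = 0 := by
  refine (Submodule.span_eq_bot.2 ?_).le hv
  rintro _ ⟨p, q, hp, hq, hpq, rfl⟩
  rcases (by omega : n ≤ p.length ∨ n ≤ q.length) with hn | hn
  · rw [h p hp hn, zero_mul, zero_mul]
  · rw [h q hq hn, mul_zero]

theorem productsVanish_ad {a b : R} {n : ℕ} (h : ProductsVanish {a, b} n) :
    ProductsVanish {LieAlgebra.ad ℂ R a, LieAlgebra.ad ℂ R b} (2 * n) := by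
  intro l hl hn
  refine LinearMap.ext fun t => eq_zero_of_mem_sandwichSpan h hn (t := t) ?_
  clear hn
  induction l with
  | nil => exact Submodule.subset_span ⟨[], [], by simp, by simp, rfl, by simp⟩
  | cons u l ih =>
    have hu := hl u List.mem_cons_self
    have ih := ih fun v hv => hl v (List.mem_cons_of_mem _ hv)
    rw [List.prod_cons, Module.End.mul_apply]
    rcases hu with rfl | rfl <;> exact lie_mem_sandwichSpan (by simp) ih

theorem lnest_eq_zero {a b : R} {n : ℕ} (h : ProductsVanish {a, b} n) {w : List Bool}
    (hw : 2 * n ≤ w.length) : lnest a b w = 0 := by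
  refine eq_zero_of_mem_sandwichSpan h hw (t := 1) ?_
  clear hw
  induction w with
  | nil => simp [lnest]
  | cons c w ih =>
    rcases w with _ | ⟨d, w⟩
    · refine Submodule.subset_span ⟨[if c then a else b], [], ?_, by simp, by simp, ?_⟩
      · cases c <;> simp
      · simp [lnest]
    · exact lie_mem_sandwichSpan (by cases c <;> simp) ih

theorem wordProd_ad_apply {a b e : R} (ha : ⁅e, a⁆ = a) (hb : ⁅e, b⁆ = b) {w : List Bool}
    (hw : w ≠ []) :
    wordProd (LieAlgebra.ad ℂ R a) (LieAlgebra.ad ℂ R b) w e = -lnest a b w := by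
  induction w with
  | nil => exact absurd rfl hw
  | cons c w ih =>
    rcases w with _ | ⟨d, w⟩
    · rw [← lie_skew, neg_eq_iff_eq_neg] at ha hb
      cases c <;> simp [wordProd, lnest, ha, hb]
    · have := ih (by simp)
      rw [← List.singleton_append, wordProd_append, Module.End.mul_apply, this]
      cases c <;> simp [wordProd, lnest_cons_cons]

theorem lie_lnest {a b e : R} (ha : ⁅e, a⁆ = a) (hb : ⁅e, b⁆ = b) (w : List Bool) :
    ⁅e, lnest a b w⁆ = (w.length : ℂ) • lnest a b w := by
  induction w with
  | nil => simp [lnest]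
  | cons c w ih =>
    rcases w with _ | ⟨d, w⟩
    · cases c <;> simp [lnest, ha, hb]
    · rw [lnest_cons_cons, leibniz_lie, ih, List.length_cons (a := c), lie_smul]
      cases c <;> simp [ha, hb, add_smul, add_comm]

theorem lie_logWordSum {a b e : R} {n : ℕ} (h : ProductsVanish {a, b} (n + 1))
    (ha : ⁅e, a⁆ = a) (hb : ⁅e, b⁆ = b) :
    ⁅e, logWordSum a b (n + 1)⁆ = ⁅e, lbch a b⁆ := by
  have hz := isNilpotent_logWordSum h
  have had : LieAlgebra.ad ℂ R (logWordSum a b (n + 1)) =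
      logWordSum (LieAlgebra.ad ℂ R a) (LieAlgebra.ad ℂ R b) (2 * n + 1 + 1) :=
    eq_logWordSum_of_nexp_eq (productsVanish_ad h) (isNilpotent_ad hz)
      (nexp_ad_of_nexp_eq_mul (h.isNilpotent (by simp)) (h.isNilpotent (by simp)) hz
        (nexp_logWordSum h))
  have h1 : ⁅logWordSum a b (n + 1), e⁆ =
      logWordSum (LieAlgebra.ad ℂ R a) (LieAlgebra.ad ℂ R b) (2 * n + 1 + 1) e := by
    rw [← had, LieAlgebra.ad_apply]
  rw [lbch_eq_sum (N := 2 * n + 1 + 1) fun w hw => lnest_eq_zero h hw, ← lie_skew, h1, logWordSum,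
    LinearMap.sum_apply, lie_sum, ← Finset.sum_neg_distrib]
  refine Finset.sum_congr rfl fun P hP => ?_
  rw [lie_smul, lie_lnest ha hb, smul_smul, bchCoeff_mul_length hP, LinearMap.smul_apply]
  by_cases h0 : P = []
  · simp [h0, logCoeff_nil]
  · rw [wordProd_ad_apply ha hb (bchWord_ne_nil hP h0), smul_neg, neg_neg]

end AssociativeBCH

section PolynomialTrick

attribute [local instance] LieRing.ofAssociativeRing

open Polynomial (monomial X derivative)
open scoped Polynomial

variable {R : Type*} [Ring R] [Algebra ℂ R]

variable (R) in
/-- The Euler operator `X d/dX` on polynomials. -/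
def eulerOp : Module.End ℂ R[X] :=
  LinearMap.mulLeft ℂ X * (derivative : R[X] →ₗ[R] R[X]).restrictScalars ℂ

theorem eulerOp_apply (p : R[X]) : eulerOp R p = X * derivative p := rfl

theorem lie_eulerOp_lmul (p : R[X]) :
    ⁅eulerOp R, Algebra.lmul ℂ R[X] p⁆ = Algebra.lmul ℂ R[X] (eulerOp R p) := by
  refine LinearMap.ext fun q => ?_
  rw [Ring.lie_def]
  change X * derivative (p * q) - p * (X * derivative q) = X * derivative p * q
  rw [Polynomial.derivative_mul, mul_add, ← mul_assoc, ← mul_assoc, ← mul_assoc,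
    Polynomial.X_mul (p := p), add_sub_cancel_right]

theorem eulerOp_monomial_one (r : R) : eulerOp R (monomial 1 r) = monomial 1 r := by
  rw [eulerOp_apply, Polynomial.derivative_monomial, Polynomial.X_mul_monomial]
  simp

theorem eq_of_eulerOp_eq {p q : R[X]} (h : eulerOp R p = eulerOp R q)
    (h0 : p.coeff 0 = q.coeff 0) : p = q := by
  ext k
  rcases k with _ | k
  · exact h0
  · have hk := congrArg (fun r => r.coeff (k + 1)) h
    simp only [eulerOp_apply, Polynomial.coeff_X_mul, Polynomial.coeff_derivative] at hk
    have hc : ((k : ℂ) + 1) ≠ 0 := by exact_mod_cast k.succ_ne_zero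
    have hsmul : ∀ r : R, r * ((k : R) + 1) = ((k : ℂ) + 1) • r := fun r => by
      rw [Algebra.smul_def, Algebra.commutes]; simp
    rw [hsmul, hsmul] at hk
    exact (smul_right_injective R hc) hk

variable (R) in
/-- Evaluation of polynomials at a complex number. -/
def evalAt (t : ℂ) : R[X] →ₐ[ℂ] R :=
  { Polynomial.eval₂RingHom' (RingHom.id R) (algebraMap ℂ R t)
      fun r => (Algebra.commutes t r).symm with
    commutes' := fun _ => Polynomial.eval₂_C (RingHom.id R) (algebraMap ℂ R t) }

theorem evalAt_apply (t : ℂ) (p : R[X]) : evalAt R t p = p.eval (algebraMap ℂ R t) := rfl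

theorem map_wordProd {S : Type*} [Ring S] [Algebra ℂ S] (f : R →ₐ[ℂ] S) (a b : R)
    (w : List Bool) : f (wordProd a b w) = wordProd (f a) (f b) w := by
  rw [wordProd, map_list_prod, List.map_map, wordProd]
  congr 2
  ext c
  cases c <;> simp

theorem map_logWordSum {S : Type*} [Ring S] [Algebra ℂ S] (f : R →ₐ[ℂ] S) (a b : R)
    (N : ℕ) : f (logWordSum a b N) = logWordSum (f a) (f b) N := by
  simp [logWordSum, map_wordProd]

theorem logWordSum_zero_zero (N : ℕ) : logWordSum (0 : R) 0 N = 0 := by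
  refine Finset.sum_eq_zero fun P hP => ?_
  by_cases h0 : P = []
  · simp [h0, logCoeff_nil]
  · obtain ⟨c, w, hw⟩ := List.exists_cons_of_ne_nil (bchWord_ne_nil hP h0)
    rw [hw]
    simp [wordProd]

theorem lbch_zero_zero {𝔤 : Type*} [LieRing 𝔤] [LieAlgebra ℂ 𝔤] : lbch (0 : 𝔤) 0 = 0 := by
  simp [lbch, lnest_zero]

theorem logWordSum_eq_lbch {a b : R} {n : ℕ} (h : ProductsVanish {a, b} (n + 1)) :
    logWordSum a b (n + 1) = lbch a b := by
  have h1 : ProductsVanish {monomial 1 a, monomial 1 b} (n + 1) := by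
    simpa [Set.image_pair] using h.monomial_one
  have h2 : ProductsVanish {Algebra.lmul ℂ R[X] (monomial 1 a),
      Algebra.lmul ℂ R[X] (monomial 1 b)} (n + 1) := by
    simpa only [Set.image_pair] using h1.map (Algebra.lmul ℂ R[X])
  have hlie := lie_logWordSum h2 (e := eulerOp R)
    (by rw [lie_eulerOp_lmul, eulerOp_monomial_one]) (by rw [lie_eulerOp_lmul, eulerOp_monomial_one])
  have hvan := fun (w : List Bool) hw => lnest_eq_zero h1 (w := w) hw
  have hmap : ∀ (t : ℂ), evalAt R t (lbch (monomial 1 a) (monomial 1 b)) =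
      lbch (evalAt R t (monomial 1 a)) (evalAt R t (monomial 1 b)) :=
    fun t => map_lbch (evalAt R t).toLieHom hvan
  have hlmul := map_lbch (Algebra.lmul ℂ R[X]).toLieHom hvan
  simp only [AlgHom.coe_toLieHom] at hlmul
  rw [← hlmul, ← map_logWordSum, lie_eulerOp_lmul, lie_eulerOp_lmul] at hlie
  have heq : logWordSum (monomial 1 a) (monomial 1 b) (n + 1) =
      lbch (monomial 1 a) (monomial 1 b) := by
    refine eq_of_eulerOp_eq (Algebra.lmul_injective hlie) ?_
    have := hmap 0
    have h0 := map_logWordSum (evalAt R 0) (monomial 1 a) (monomial 1 b) (n + 1)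
    simp only [evalAt_apply, map_zero, Polynomial.eval_monomial, pow_one, mul_zero,
      logWordSum_zero_zero, lbch_zero_zero] at this h0
    rw [Polynomial.coeff_zero_eq_eval_zero, Polynomial.coeff_zero_eq_eval_zero, this, h0]
  have h1' := hmap 1
  rw [← heq, map_logWordSum] at h1'
  simpa [evalAt_apply] using h1'

theorem nexp_lbch {a b : R} {n : ℕ} (h : ProductsVanish {a, b} n) :
    IsNilpotent (lbch a b) ∧ nexp (lbch a b) = nexp a * nexp b := by
  have h' := h.mono n.le_succ
  rw [← logWordSum_eq_lbch h']
  exact ⟨isNilpotent_logWordSum h', nexp_logWordSum h'⟩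

end PolynomialTrick

attribute [local instance] LieRing.ofAssociativeRing

/-- Products of at least `n` operators in the image of a representation vanish. -/
def ActsNilpotently {𝔤 V : Type*} [LieRing 𝔤] [LieAlgebra ℂ 𝔤] [AddCommGroup V] [Module ℂ V]
    (ρ : 𝔤 →ₗ⁅ℂ⁆ Module.End ℂ V) (n : ℕ) : Prop :=
  ∀ l : List 𝔤, n ≤ l.length → (l.map ρ).prod = 0

section NilpotentRepresentations

variable {𝔤 V : Type*} [LieRing 𝔤] [LieAlgebra ℂ 𝔤] [AddCommGroup V] [Module ℂ V]
variable {ρ : 𝔤 →ₗ⁅ℂ⁆ Module.End ℂ V} {n : ℕ}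

theorem ActsNilpotently.isNilpotent (h : ActsNilpotently ρ n) (x : 𝔤) : IsNilpotent (ρ x) :=
  ⟨n, by simpa using h (List.replicate n x) (by simp)⟩

theorem ActsNilpotently.productsVanish (h : ActsNilpotently ρ n) (x y : 𝔤) :
    ProductsVanish {ρ x, ρ y} n := by
  intro l hl hn
  obtain ⟨l', rfl⟩ : ∃ l' : List 𝔤, l'.map ρ = l := by
    clear hn
    induction l with
    | nil => exact ⟨[], rfl⟩
    | cons u l ih =>
      obtain ⟨l', rfl⟩ := ih fun v hv => hl v (List.mem_cons_of_mem _ hv)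
      rcases hl u List.mem_cons_self with rfl | rfl
      exacts [⟨x :: l', rfl⟩, ⟨y :: l', rfl⟩]
  exact h l' (by simpa using hn)

theorem exists_lnest_eq (x y : 𝔤) {w : List Bool} (hw : w ≠ []) :
    ∃ (l : List 𝔤) (z : 𝔤), l.length + 1 = w.length ∧
      lnest x y w = (l.map (LieAlgebra.ad ℂ 𝔤)).prod z := by
  induction w with
  | nil => exact absurd rfl hw
  | cons b w ih =>
    rcases w with _ | ⟨c, w⟩
    · exact ⟨[], if b then x else y, rfl, rfl⟩
    · obtain ⟨l, z, hl, hz⟩ := ih (by simp)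
      refine ⟨(if b then x else y) :: l, z, by simpa using hl, ?_⟩
      rw [lnest_cons_cons, hz, List.map_cons, List.prod_cons, Module.End.mul_apply,
        LieAlgebra.ad_apply]

theorem ActsNilpotently.lnest_eq_zero (h : ActsNilpotently (LieAlgebra.ad ℂ 𝔤) n) (x y : 𝔤)
    {w : List Bool} (hw : n + 1 ≤ w.length) : lnest x y w = 0 := by
  obtain ⟨l, z, hl, hz⟩ := exists_lnest_eq x y (w := w) (by rintro rfl; simp at hw)
  rw [hz, h l (by omega), LinearMap.zero_apply]

theorem map_lbch_of_actsNilpotently {𝔥 : Type*} [LieRing 𝔥] [LieAlgebra ℂ 𝔥]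
    (h : ActsNilpotently (LieAlgebra.ad ℂ 𝔤) n) (φ : 𝔤 →ₗ⁅ℂ⁆ 𝔥) (x y : 𝔤) :
    φ (lbch x y) = lbch (φ x) (φ y) :=
  map_lbch φ fun _ hw => h.lnest_eq_zero x y hw

/-- A representation on which the Lie algebra acts nilpotently turns the
Baker-Campbell-Hausdorff product into the product of exponentials. -/
theorem nexp_apply_lbch {m : ℕ} (h : ActsNilpotently (LieAlgebra.ad ℂ 𝔤) n)
    (hρ : ActsNilpotently ρ m) (x y : 𝔤) : nexp (ρ (lbch x y)) = nexp (ρ x) * nexp (ρ y) := by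
  rw [map_lbch_of_actsNilpotently h]
  exact (nexp_lbch (hρ.productsVanish x y)).2

/-- The affine representation `u (v, s) = (u v + s δ u, 0)` attached to a cocycle `δ`. -/
def affineRep (ρ : 𝔤 →ₗ⁅ℂ⁆ Module.End ℂ V) (δ : 𝔤 →ₗ[ℂ] V)
    (hδ : ∀ a b, δ ⁅a, b⁆ = ρ a (δ b) - ρ b (δ a)) : 𝔤 →ₗ⁅ℂ⁆ Module.End ℂ (V × ℂ) where
  toFun u := LinearMap.inl ℂ V ℂ ∘ₗ (LinearMap.coprod (ρ u) (LinearMap.toSpanSingleton ℂ V (δ u)))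
  map_add' a b := by
    refine LinearMap.ext fun p => ?_
    simp [add_add_add_comm]
  map_smul' c a := by
    refine LinearMap.ext fun p => ?_
    simp [smul_comm _ c]
  map_lie' {a b} := by
    refine LinearMap.ext fun p => ?_
    simp [Ring.lie_def, hδ, smul_sub]
    abel

theorem affineRep_apply {δ : 𝔤 →ₗ[ℂ] V} (hδ : ∀ a b, δ ⁅a, b⁆ = ρ a (δ b) - ρ b (δ a))
    (u : 𝔤) (v : V) (s : ℂ) : affineRep ρ δ hδ u (v, s) = (ρ u v + s • δ u, 0) := rfl

theorem ActsNilpotently.affineRep {δ : 𝔤 →ₗ[ℂ] V}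
    (hδ : ∀ a b, δ ⁅a, b⁆ = ρ a (δ b) - ρ b (δ a)) (h : ActsNilpotently ρ n) :
    ActsNilpotently (affineRep ρ δ hδ) (n + 1) := by
  have key : ∀ (l : List 𝔤) (v : V),
      (l.map (_root_.affineRep ρ δ hδ)).prod (v, 0) = ((l.map ρ).prod v, 0) := by
    intro l v
    induction l with
    | nil => rfl
    | cons u l ih =>
      rw [List.map_cons, List.prod_cons, Module.End.mul_apply, ih, affineRep_apply, zero_smul,
        add_zero]
      rfl
  intro l hl
  rcases l.eq_nil_or_concat' with rfl | ⟨l', u, rfl⟩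
  · simp at hl
  · refine LinearMap.ext fun p => ?_
    rw [List.map_append, List.prod_append, Module.End.mul_apply, List.map_singleton,
      List.prod_singleton, show p = (p.1, p.2) from rfl, affineRep_apply, key,
      h l' (by simpa using hl)]
    rfl

end NilpotentRepresentations

section PolynomialExtension

open scoped Polynomial

variable (𝔤 : Type*) [LieRing 𝔤] [LieAlgebra ℂ 𝔤]

/-- The derivation `X d/dX` of `𝔤[X]`. -/
def eulerDer : ℂ[X] ⊗[ℂ] 𝔤 →ₗ[ℂ] ℂ[X] ⊗[ℂ] 𝔤 := (eulerOp ℂ).rTensor 𝔤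

theorem eulerDer_lie (u v : ℂ[X] ⊗[ℂ] 𝔤) : eulerDer 𝔤 (LieAlgebra.ad ℂ _ u v) =
    LieAlgebra.ad ℂ _ u (eulerDer 𝔤 v) - LieAlgebra.ad ℂ _ v (eulerDer 𝔤 u) := by
  simp only [LieAlgebra.ad_apply]
  induction u with
  | zero => simp
  | add a b ha hb => simp only [add_lie, lie_add, map_add, ha, hb]; abel
  | tmul p x =>
    induction v with
    | zero => simp
    | add a b ha hb => simp only [add_lie, lie_add, map_add, ha, hb]; abel
    | tmul q y =>
      simp only [eulerDer, LinearMap.rTensor_tmul, LieAlgebra.ExtendScalars.bracket_tmul,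
        eulerOp_apply, Polynomial.derivative_mul]
      rw [← lie_skew x y, TensorProduct.tmul_neg, TensorProduct.tmul_neg, ← neg_add',
        ← TensorProduct.add_tmul]
      congr 2
      ring

/-- Evaluation of `𝔤[X]` at a complex number. -/
def evalLie (t : ℂ) : ℂ[X] ⊗[ℂ] 𝔤 →ₗ⁅ℂ⁆ 𝔤 :=
  { TensorProduct.lift ((LinearMap.lsmul ℂ 𝔤).comp (Polynomial.aeval t).toLinearMap) with
    map_lie' := fun {u v} => by
      simp only [AddHom.toFun_eq_coe, LinearMap.coe_toAddHom]
      induction u with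
      | zero => simp
      | add a b ha hb => simp only [add_lie, map_add, ha, hb]
      | tmul p x =>
        induction v with
        | zero => simp
        | add a b ha hb => simp only [lie_add, map_add, ha, hb]
        | tmul q y => simp [LieAlgebra.ExtendScalars.bracket_tmul, smul_smul, mul_comm] }

theorem evalLie_tmul (t : ℂ) (p : ℂ[X]) (x : 𝔤) : evalLie 𝔤 t (p ⊗ₜ x) = p.eval t • x := by
  rw [← Polynomial.coe_aeval_eq_eval]
  rfl

theorem evalLie_one_eq_of_eulerDer_eq {u v : ℂ[X] ⊗[ℂ] 𝔤} (h : eulerDer 𝔤 u = eulerDer 𝔤 v)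
    (h0 : evalLie 𝔤 0 u = evalLie 𝔤 0 v) : evalLie 𝔤 1 u = evalLie 𝔤 1 v := by
  let κ : ℂ[X] →ₗ[ℂ] ℂ := Polynomial.lsum fun n => (n : ℂ)⁻¹ • LinearMap.id
  have hκ : ∀ p : ℂ[X], κ (eulerOp ℂ p) = p.eval 1 - p.eval 0 := by
    intro p
    induction p using Polynomial.induction_on' with
    | add p q hp hq => simp only [map_add, hp, hq, Polynomial.eval_add]; ring
    | monomial n a =>
      rw [eulerOp_apply, Polynomial.derivative_monomial, Polynomial.X_mul_monomial]
      rcases n with _ | n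
      · simp
      · have hn : ((n : ℂ) + 1) ≠ 0 := by exact_mod_cast n.succ_ne_zero
        simp [κ, Polynomial.lsum_apply]
        field_simp
  have key : ∀ w : ℂ[X] ⊗[ℂ] 𝔤, evalLie 𝔤 1 w =
      evalLie 𝔤 0 w + TensorProduct.lift ((LinearMap.lsmul ℂ 𝔤).comp κ) (eulerDer 𝔤 w) := by
    intro w
    induction w with
    | zero => simp
    | add a b ha hb => simp only [map_add, ha, hb]; abel
    | tmul p x =>
      rw [evalLie_tmul, evalLie_tmul, eulerDer, LinearMap.rTensor_tmul, TensorProduct.lift.tmul,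
        LinearMap.comp_apply, hκ, LinearMap.lsmul_apply, ← add_smul, add_sub_cancel]
  rw [key u, key v, h, h0]

variable {𝔤}

theorem ActsNilpotently.ad_polynomial {n : ℕ} (h : ActsNilpotently (LieAlgebra.ad ℂ 𝔤) n) :
    ActsNilpotently (LieAlgebra.ad ℂ (ℂ[X] ⊗[ℂ] 𝔤)) n := by
  have key : ∀ (l : List (ℂ[X] ⊗[ℂ] 𝔤)) (t : ℂ[X] ⊗[ℂ] 𝔤),
      (l.map (LieAlgebra.ad ℂ (ℂ[X] ⊗[ℂ] 𝔤))).prod t ∈ Submodule.span ℂ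
        {r | ∃ (l' : List 𝔤) (p : ℂ[X]) (x : 𝔤), l'.length = l.length ∧
          r = p ⊗ₜ (l'.map (LieAlgebra.ad ℂ 𝔤)).prod x} := by
    intro l t
    induction l with
    | nil =>
      induction t with
      | zero => simp
      | add a b ha hb => rw [map_add]; exact Submodule.add_mem _ ha hb
      | tmul p x => exact Submodule.subset_span ⟨[], p, x, rfl, rfl⟩
    | cons u l ih =>
      rw [List.map_cons, List.prod_cons, Module.End.mul_apply, LieAlgebra.ad_apply]
      generalize (l.map (LieAlgebra.ad ℂ (ℂ[X] ⊗[ℂ] 𝔤))).prod t = s at ih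
      induction ih using Submodule.span_induction with
      | zero => simp
      | add a b _ _ ha hb => rw [lie_add]; exact Submodule.add_mem _ ha hb
      | smul c a _ ha => rw [lie_smul]; exact Submodule.smul_mem _ _ ha
      | mem r hr =>
        obtain ⟨l', p, x, hl, rfl⟩ := hr
        induction u with
        | zero => simp
        | add a b ha hb => rw [add_lie]; exact Submodule.add_mem _ ha hb
        | tmul q y => exact Submodule.subset_span ⟨y :: l', q * p, x, by simp [hl], rfl⟩
  intro l hl
  refine LinearMap.ext fun t => (Submodule.span_eq_bot.2 ?_).le (key l t)
  rintro _ ⟨l', p, x, hl', rfl⟩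
  rw [h l' (by omega), LinearMap.zero_apply, TensorProduct.tmul_zero]

/-- The affine representation of `𝔤[X]` attached to the derivation `X d/dX`. -/
abbrev eulerRep (𝔤 : Type*) [LieRing 𝔤] [LieAlgebra ℂ 𝔤] :
    ℂ[X] ⊗[ℂ] 𝔤 →ₗ⁅ℂ⁆ Module.End ℂ ((ℂ[X] ⊗[ℂ] 𝔤) × ℂ) :=
  affineRep (LieAlgebra.ad ℂ (ℂ[X] ⊗[ℂ] 𝔤)) (eulerDer 𝔤) (eulerDer_lie 𝔤)

theorem ActsNilpotently.eulerRep {n : ℕ} (h : ActsNilpotently (LieAlgebra.ad ℂ 𝔤) n) :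
    ActsNilpotently (eulerRep 𝔤) (n + 1) := h.ad_polynomial.affineRep _

theorem evalLie_one_eq_of_nexp_eulerRep_eq {n : ℕ}
    (h : ActsNilpotently (LieAlgebra.ad ℂ 𝔤) n) {u v : ℂ[X] ⊗[ℂ] 𝔤}
    (he : nexp (eulerRep 𝔤 u) = nexp (eulerRep 𝔤 v))
    (h0 : evalLie 𝔤 0 u = evalLie 𝔤 0 v) : evalLie 𝔤 1 u = evalLie 𝔤 1 v := by
  refine evalLie_one_eq_of_eulerDer_eq 𝔤 ?_ h0
  have := nexp_injective (h.eulerRep.isNilpotent u) (h.eulerRep.isNilpotent v) he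
  have key : LieAlgebra.ad ℂ _ u 0 + (1 : ℂ) • eulerDer 𝔤 u =
      LieAlgebra.ad ℂ _ v 0 + (1 : ℂ) • eulerDer 𝔤 v :=
    congrArg (fun T : Module.End ℂ ((ℂ[X] ⊗[ℂ] 𝔤) × ℂ) => (T (0, 1)).1) this
  simpa using key

theorem nexp_eulerRep_lbch {n : ℕ} (h : ActsNilpotently (LieAlgebra.ad ℂ 𝔤) n)
    (u v : ℂ[X] ⊗[ℂ] 𝔤) :
    nexp (eulerRep 𝔤 (lbch u v)) = nexp (eulerRep 𝔤 u) * nexp (eulerRep 𝔤 v) :=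
  nexp_apply_lbch h.ad_polynomial h.eulerRep u v

theorem evalLie_lbch {n : ℕ} (h : ActsNilpotently (LieAlgebra.ad ℂ 𝔤) n) (t : ℂ)
    (u v : ℂ[X] ⊗[ℂ] 𝔤) :
    evalLie 𝔤 t (lbch u v) = lbch (evalLie 𝔤 t u) (evalLie 𝔤 t v) :=
  map_lbch_of_actsNilpotently h.ad_polynomial _ u v

end PolynomialExtension

section GroupLaws

open Polynomial (X)
open scoped Polynomial

variable {𝔤 : Type*} [LieRing 𝔤] [LieAlgebra ℂ 𝔤] {n : ℕ}

theorem lbch_assoc (h : ActsNilpotently (LieAlgebra.ad ℂ 𝔤) n) (x y z : 𝔤) :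
    lbch (lbch x y) z = lbch x (lbch y z) := by
  have := evalLie_one_eq_of_nexp_eulerRep_eq h
    (u := lbch (lbch ((X : ℂ[X]) ⊗ₜ[ℂ] x) ((X : ℂ[X]) ⊗ₜ[ℂ] y)) ((X : ℂ[X]) ⊗ₜ[ℂ] z))
    (v := lbch ((X : ℂ[X]) ⊗ₜ[ℂ] x) (lbch ((X : ℂ[X]) ⊗ₜ[ℂ] y) ((X : ℂ[X]) ⊗ₜ[ℂ] z)))
    (by simp only [nexp_eulerRep_lbch h, mul_assoc])
    (by simp [evalLie_lbch h, evalLie_tmul, lbch_zero_zero])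
  simpa [evalLie_lbch h, evalLie_tmul] using this

theorem lbch_zero_left (h : ActsNilpotently (LieAlgebra.ad ℂ 𝔤) n) (x : 𝔤) : lbch 0 x = x := by
  have := evalLie_one_eq_of_nexp_eulerRep_eq h
    (u := lbch 0 ((X : ℂ[X]) ⊗ₜ[ℂ] x)) (v := (X : ℂ[X]) ⊗ₜ[ℂ] x)
    (by rw [nexp_eulerRep_lbch h, map_zero, nexp_zero, one_mul])
    (by simp [evalLie_lbch h, evalLie_tmul, lbch_zero_zero])
  simpa [evalLie_lbch h, evalLie_tmul] using this

theorem lbch_neg_left (h : ActsNilpotently (LieAlgebra.ad ℂ 𝔤) n) (x : 𝔤) :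
    lbch (-x) x = 0 := by
  have := evalLie_one_eq_of_nexp_eulerRep_eq h
    (u := lbch (-((X : ℂ[X]) ⊗ₜ[ℂ] x)) ((X : ℂ[X]) ⊗ₜ[ℂ] x)) (v := 0)
    (by rw [nexp_eulerRep_lbch h, map_neg, nexp_neg_mul_nexp (h.eulerRep.isNilpotent _), map_zero,
          nexp_zero])
    (by simp [evalLie_lbch h, evalLie_tmul, lbch_zero_zero])
  simpa [evalLie_lbch h, evalLie_tmul] using this

theorem evalLie_nexp_ad (h : ActsNilpotently (LieAlgebra.ad ℂ 𝔤) n) (t : ℂ)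
    (u v : ℂ[X] ⊗[ℂ] 𝔤) : evalLie 𝔤 t (nexp (LieAlgebra.ad ℂ _ u) v) =
      nexp (LieAlgebra.ad ℂ 𝔤 (evalLie 𝔤 t u)) (evalLie 𝔤 t v) :=
  (nexp_apply_of_intertwine (h.ad_polynomial.isNilpotent u) (h.isNilpotent _)
    (evalLie 𝔤 t : ℂ[X] ⊗[ℂ] 𝔤 →ₗ[ℂ] 𝔤)
    (fun w => by simp) v).symm

theorem lbch_conj (h : ActsNilpotently (LieAlgebra.ad ℂ 𝔤) n) (x y : 𝔤) :
    lbch x (lbch y (-x)) = nexp (LieAlgebra.ad ℂ 𝔤 x) y := by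
  have hX := h.eulerRep.isNilpotent ((X : ℂ[X]) ⊗ₜ[ℂ] x)
  have := evalLie_one_eq_of_nexp_eulerRep_eq h
    (u := lbch ((X : ℂ[X]) ⊗ₜ[ℂ] x) (lbch ((X : ℂ[X]) ⊗ₜ[ℂ] y) (-((X : ℂ[X]) ⊗ₜ[ℂ] x))))
    (v := nexp (LieAlgebra.ad ℂ _ ((X : ℂ[X]) ⊗ₜ[ℂ] x)) ((X : ℂ[X]) ⊗ₜ[ℂ] y))
    (by
      rw [nexp_eulerRep_lbch h, nexp_eulerRep_lbch h, map_neg, ← mul_assoc,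
        ← nexp_nexp_ad_apply hX (h.eulerRep.isNilpotent _)]
      congr 1
      exact nexp_apply_of_intertwine (h.ad_polynomial.isNilpotent _) (isNilpotent_ad hX)
        (eulerRep 𝔤).toLinearMap (fun w => ((eulerRep 𝔤).map_lie _ w).symm) _)
    (by simp [evalLie_lbch h, evalLie_nexp_ad h, evalLie_tmul, lbch_zero_zero])
  simpa [evalLie_lbch h, evalLie_nexp_ad h, evalLie_tmul] using this

end GroupLaws

namespace GLD

variable (K : GLD)

/-- Transport along an equality of degrees, as a linear map. -/
def trLin {i j : ℤ} (h : i = j) : K.V i →ₗ[ℂ] K.V j where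
  toFun := K.tr h
  map_add' x y := by subst h; rfl
  map_smul' c x := by subst h; rfl

theorem trLin_apply {i j : ℤ} (h : i = j) (x : K.V i) : K.trLin h x = K.tr h x := rfl

end GLD

namespace DGLA

variable (K : DGLA)

/-- The bracket with values in a prescribed degree. -/
def brTo {i j k : ℤ} (h : i + j = k) : K.V i →ₗ[ℂ] K.V j →ₗ[ℂ] K.V k :=
  (K.brLin i j).compr₂ (K.trLin h)

/-- The differential with values in a prescribed degree. -/
def dTo {i k : ℤ} (h : i + 1 = k) : K.V i →ₗ[ℂ] K.V k := K.trLin h ∘ₗ K.dLin i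

theorem brTo_apply {i j k : ℤ} (h : i + j = k) (x : K.V i) (y : K.V j) :
    K.brTo h x y = K.tr h (K.br i j x y) := rfl

theorem brTo_brTo {i j k m n p q : ℤ} (h₁ : j + k = m) (h₂ : i + m = n) (h₃ : i + j = p)
    (h₄ : p + k = n) (h₅ : i + k = q) (h₆ : j + q = n) (x : K.V i) (y : K.V j) (z : K.V k) :
    K.brTo h₂ x (K.brTo h₁ y z) = K.brTo h₄ (K.brTo h₃ x y) z +
      ((Int.negOnePow (i * j) : ℤˣ) : ℤ) • K.brTo h₆ y (K.brTo h₅ x z) := by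
  subst h₁ h₂ h₃ h₅
  exact K.jacobi i j k x y z

theorem dTo_brTo {i j k m n p : ℤ} (h₁ : i + j = k) (h₂ : k + 1 = m) (h₃ : i + 1 = n)
    (h₄ : n + j = m) (h₅ : j + 1 = p) (h₆ : i + p = m) (x : K.V i) (y : K.V j) :
    K.dTo h₂ (K.brTo h₁ x y) = K.brTo h₄ (K.dTo h₃ x) y +
      ((Int.negOnePow i : ℤˣ) : ℤ) • K.brTo h₆ x (K.dTo h₅ y) := by
  subst h₁ h₂ h₃ h₅
  exact K.leibniz i j x y

theorem dTo_dTo {i k m : ℤ} (h : i + 1 = k) (h' : k + 1 = m) (x : K.V i) :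
    K.dTo h' (K.dTo h x) = 0 := by
  subst h h'
  exact K.d_sq i x

theorem brTo_swap {i j k : ℤ} (h : i + j = k) (h' : j + i = k) (x : K.V i) (y : K.V j) :
    K.brTo h x y = -(((Int.negOnePow (i * j) : ℤˣ) : ℤ) • K.brTo h' y x) := by
  subst h
  rw [brTo_apply, brTo_apply]
  refine (K.antisym i j x y).trans ?_
  rw [← GLD.trLin_apply, map_zsmul, GLD.trLin_apply]

/-- The bracket of degree-zero elements makes `K⁰` a Lie ring. -/
instance : LieRing (K.V 0) where
  bracket a b := K.ad00 a b
  add_lie a b c := LinearMap.map_add₂ (K.brTo (zero_add 0)) a b c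
  lie_add a b c := (K.brTo (zero_add 0) a).map_add b c
  lie_self a := by
    have h := K.brTo_swap (zero_add 0) (zero_add 0) a a
    simp only [mul_zero, Int.negOnePow_zero, Units.val_one, one_smul] at h
    have h2 : (2 : ℂ) • K.brTo (zero_add 0) a a = 0 := by
      rw [two_smul]; exact eq_neg_iff_add_eq_zero.1 h
    exact (smul_eq_zero.1 h2).resolve_left two_ne_zero
  leibniz_lie a b c := by
    have h := K.brTo_brTo (zero_add 0) (zero_add 0) (zero_add 0) (zero_add 0) (zero_add 0)
      (zero_add 0) a b c
    simp only [mul_zero, Int.negOnePow_zero, Units.val_one, one_smul] at h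
    exact h

instance : LieAlgebra ℂ (K.V 0) where
  lie_smul c a b := (K.brTo (zero_add 0) a).map_smul c b

theorem lie_eq_brTo (a b : K.V 0) : ⁅a, b⁆ = K.brTo (zero_add 0) a b := rfl

/-- The adjoint representation of `K⁰` on `Kⁱ`. -/
def rep (i : ℤ) : K.V 0 →ₗ⁅ℂ⁆ Module.End ℂ (K.V i) :=
  { K.brTo (zero_add i) with
    map_lie' := fun {a b} => by
      refine LinearMap.ext fun x => ?_
      have h := K.brTo_brTo (zero_add i) (zero_add i) (zero_add 0) (zero_add i) (zero_add i)
        (zero_add i) a b x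
      simp only [mul_zero, Int.negOnePow_zero, Units.val_one, one_smul] at h
      rw [Ring.lie_def, LinearMap.sub_apply]
      exact eq_sub_of_add_eq h.symm }

theorem rep_apply (i : ℤ) (a : K.V 0) (x : K.V i) : K.rep i a x = K.brTo (zero_add i) a x := rfl

theorem nest_eq_lnest (x y : K.V 0) (w : List Bool) : K.nest x y w = lnest x y w := by
  induction w with
  | nil => rfl
  | cons b w ih =>
    rcases w with _ | ⟨c, w⟩
    · rfl
    · rw [lnest_cons_cons, ← ih]; rfl

theorem bch_eq_lbch (x y : K.V 0) : K.bch x y = lbch x y := by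
  simp only [GLD.bch, lbch, nest_eq_lnest]

/-- The infinitesimal gauge action `a (x, s) = ([a, x] - s da, 0)`. -/
def gaugeRep : K.V 0 →ₗ⁅ℂ⁆ Module.End ℂ (K.V 1 × ℂ) :=
  affineRep (K.rep 1) (-K.dTo (zero_add 1)) fun a b => by
    have h1 := K.dTo_brTo (zero_add 0) (zero_add 1) (zero_add 1) (add_zero 1) (zero_add 1)
      (zero_add 1) a b
    have h2 := K.brTo_swap (add_zero 1) (zero_add 1) (K.dTo (zero_add 1) a) b
    simp only [mul_zero, Int.negOnePow_zero, Units.val_one, one_smul] at h1 h2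
    simp only [lie_eq_brTo, rep_apply, LinearMap.neg_apply, map_neg, h1, h2]
    abel

theorem gaugeRep_apply (a : K.V 0) (x : K.V 1) (s : ℂ) :
    K.gaugeRep a (x, s) = (K.rep 1 a x - s • K.dTo (zero_add 1) a, 0) := by
  rw [gaugeRep, affineRep_apply, LinearMap.neg_apply, smul_neg, sub_eq_add_neg]

/-- The degree-zero part acts nilpotently in every degree. -/
def ActsNilp (n : ℕ) : Prop := ∀ i, ActsNilpotently (K.rep i) n

variable {K} {n : ℕ}

theorem ActsNilp.gaugeRep (hK : K.ActsNilp n) : ActsNilpotently K.gaugeRep (n + 1) :=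
  (hK 1).affineRep _

theorem gaugeRep_pow (a : K.V 0) (x : K.V 1) (s : ℂ) (k : ℕ) :
    (K.gaugeRep a ^ (k + 1)) (x, s) =
      ((K.rep 1 a ^ k) (K.rep 1 a x - s • K.dTo (zero_add 1) a), 0) := by
  induction k with
  | zero => simp [gaugeRep_apply]
  | succ k ih =>
    rw [pow_succ', Module.End.mul_apply, ih, gaugeRep_apply, zero_smul, sub_zero, pow_succ' _ k]
    rfl

theorem nexp_gaugeRep (hK : K.ActsNilp n) (a : K.V 0) (x : K.V 1) :
    nexp (K.gaugeRep a) (x, 1) = (K.gauge a x, 1) := by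
  have h1 : K.rep 1 a ^ n = 0 := by simpa using hK 1 (List.replicate n a) (by simp)
  have h2 : K.gaugeRep a ^ (n + 1) = 0 := by
    simpa using hK.gaugeRep (List.replicate (n + 1) a) (by simp)
  have h3 : K.gauge a x = x + ∑ᶠ k : ℕ, (((k + 1).factorial : ℂ))⁻¹ •
      (K.rep 1 a ^ k) (K.rep 1 a x - (1 : ℂ) • K.dTo (zero_add 1) a) := by
    simp only [Module.End.pow_apply, one_smul]
    rfl
  have h4 : (∑ᶠ k : ℕ, (((k + 1).factorial : ℂ))⁻¹ •
      (K.rep 1 a ^ k) (K.rep 1 a x - (1 : ℂ) • K.dTo (zero_add 1) a)) =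
      ∑ k ∈ Finset.range n, (((k + 1).factorial : ℂ))⁻¹ •
      (K.rep 1 a ^ k) (K.rep 1 a x - (1 : ℂ) • K.dTo (zero_add 1) a) := by
    refine finsum_eq_sum_of_support_subset _ fun k hk => ?_
    by_contra h
    simp only [Finset.coe_range, Set.mem_Iio, not_lt] at h
    exact hk (by simp [pow_eq_zero_of_le h h1])
  rw [h3, h4, nexp_eq_sum h2, LinearMap.sum_apply, Finset.sum_range_succ']
  simp only [LinearMap.smul_apply, gaugeRep_pow]
  ext <;> simp [Prod.fst_sum, Prod.snd_sum, add_comm]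

theorem ActsNilp.ad (hK : K.ActsNilp n) : ActsNilpotently (LieAlgebra.ad ℂ (K.V 0)) n := hK 0

theorem gauge_lbch (hK : K.ActsNilp n) (a b : K.V 0) (x : K.V 1) :
    K.gauge (lbch a b) x = K.gauge a (K.gauge b x) := by
  have h := nexp_gaugeRep hK (lbch a b) x
  rw [nexp_apply_lbch hK.ad hK.gaugeRep, Module.End.mul_apply, nexp_gaugeRep hK,
    nexp_gaugeRep hK] at h
  exact (congrArg Prod.fst h).symm

theorem gauge_zero (hK : K.ActsNilp n) (x : K.V 1) : K.gauge 0 x = x := by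
  have h := nexp_gaugeRep hK 0 x
  rw [map_zero, nexp_zero] at h
  exact (congrArg Prod.fst h).symm

theorem gauge_neg_gauge (hK : K.ActsNilp n) (a : K.V 0) (x : K.V 1) :
    K.gauge (-a) (K.gauge a x) = x := by
  rw [← gauge_lbch hK, lbch_neg_left hK.ad, gauge_zero hK]

variable (K) in
/-- The twisted differential `c ↦ s dc + [y, c]` from degree `-1` to degree `0`,
bilinear in `(y, s)` and `c`. -/
def twist : (K.V 1 × ℂ) →ₗ[ℂ] K.V (-1) →ₗ[ℂ] K.V 0 :=
  LinearMap.coprod (K.brTo (show (1 : ℤ) + -1 = 0 by omega))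
    (LinearMap.toSpanSingleton ℂ _ (K.dTo (show (-1 : ℤ) + 1 = 0 by omega)))

theorem twist_apply (y : K.V 1) (s : ℂ) (c : K.V (-1)) :
    K.twist (y, s) c = K.brTo (show (1 : ℤ) + -1 = 0 by omega) y c +
      s • K.dTo (show (-1 : ℤ) + 1 = 0 by omega) c := by
  simp [twist]

theorem lie_twist (b : K.V 0) (p : K.V 1 × ℂ) (c : K.V (-1)) :
    LieAlgebra.ad ℂ (K.V 0) b (K.twist p c) =
      K.twist (K.gaugeRep b p) c + K.twist p (K.rep (-1) b c) := by
  obtain ⟨y, s⟩ := p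
  have h1 := K.brTo_brTo (show (1 : ℤ) + -1 = 0 by omega) (zero_add 0) (zero_add 1)
    (show (1 : ℤ) + -1 = 0 by omega) (zero_add (-1)) (show (1 : ℤ) + -1 = 0 by omega) b y c
  have h2 := K.dTo_brTo (zero_add (-1)) (show (-1 : ℤ) + 1 = 0 by omega) (zero_add 1)
    (show (1 : ℤ) + -1 = 0 by omega) (show (-1 : ℤ) + 1 = 0 by omega) (zero_add 0) b c
  simp only [zero_mul, Int.negOnePow_zero, Units.val_one, one_smul] at h1 h2
  rw [gaugeRep_apply, twist_apply, twist_apply, twist_apply, LieAlgebra.ad_apply, lie_eq_brTo,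
    rep_apply, rep_apply, map_add, map_smul, map_sub, map_smul, LinearMap.sub_apply,
    LinearMap.smul_apply, h1, h2, zero_smul, smul_add]
  abel

theorem nexp_ad_twist (hK : K.ActsNilp n) (b : K.V 0) (y : K.V 1) (c : K.V (-1)) :
    nexp (LieAlgebra.ad ℂ (K.V 0) b) (K.twist (y, 1) c) =
      K.twist (K.gauge b y, 1) (nexp (K.rep (-1) b) c) := by
  rw [nexp_apply_of_bilinear (hK.gaugeRep.isNilpotent b) ((hK (-1)).isNilpotent b)
    (hK.ad.isNilpotent b) K.twist (lie_twist b), nexp_gaugeRep hK]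

theorem twist_closed {y : K.V 1} (hy : K.MC1 y) (c : K.V (-1)) :
    K.dTo (zero_add 1) (K.twist (y, 1) c) + K.brTo (add_zero 1) y (K.twist (y, 1) c) = 0 := by
  have hmc : K.dTo (show (1 : ℤ) + 1 = 2 by omega) y +
      (2 : ℂ)⁻¹ • K.brTo (show (1 : ℤ) + 1 = 2 by omega) y y = 0 := by
    have := congrArg (K.trLin (show (1 : ℤ) + 1 = 2 by omega)) hy
    rwa [map_add, map_smul, map_zero] at this
  have h1 := K.dTo_brTo (show (1 : ℤ) + -1 = 0 by omega) (zero_add 1)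
    (show (1 : ℤ) + 1 = 2 by omega) (show (2 : ℤ) + -1 = 1 by omega)
    (show (-1 : ℤ) + 1 = 0 by omega) (add_zero 1) y c
  have h2 := K.brTo_brTo (show (1 : ℤ) + -1 = 0 by omega) (add_zero 1)
    (show (1 : ℤ) + 1 = 2 by omega) (show (2 : ℤ) + -1 = 1 by omega)
    (show (1 : ℤ) + -1 = 0 by omega) (add_zero 1) y y c
  simp only [mul_one, Int.negOnePow_one, Units.val_neg, Units.val_one, neg_smul, one_smul] at h1 h2
  have h3 : K.brTo (add_zero 1) y (K.brTo (show (1 : ℤ) + -1 = 0 by omega) y c) =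
      (2 : ℂ)⁻¹ • K.brTo (show (2 : ℤ) + -1 = 1 by omega)
        (K.brTo (show (1 : ℤ) + 1 = 2 by omega) y y) c := by
    rw [eq_inv_smul_iff₀ two_ne_zero, two_smul]
    exact eq_add_neg_iff_add_eq.1 h2
  have h4 := congrArg (fun z => K.brTo (show (2 : ℤ) + -1 = 1 by omega) z c) hmc
  simp only [map_add, map_smul, LinearMap.add_apply, LinearMap.smul_apply, map_zero,
    LinearMap.zero_apply] at h4
  rw [twist_apply, one_smul, map_add, map_add, dTo_dTo, h1, h3]
  refine Eq.trans ?_ h4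
  abel

theorem lie_twist_twist {y : K.V 1} (hy : K.MC1 y) (c c' : K.V (-1)) :
    ⁅K.twist (y, 1) c, K.twist (y, 1) c'⁆ =
      K.twist (y, 1) (K.rep (-1) (K.twist (y, 1) c) c') := by
  have h := lie_twist (K.twist (y, 1) c) (y, 1) c'
  have h1 := K.brTo_swap (add_zero 1) (zero_add 1) y (K.twist (y, 1) c)
  simp only [mul_zero, Int.negOnePow_zero, Units.val_one, one_smul] at h1
  have h2 := twist_closed hy c
  rw [h1, ← sub_eq_add_neg] at h2
  rw [gaugeRep_apply, rep_apply, one_smul, ← neg_sub, h2, neg_zero, Prod.mk_zero_zero, map_zero,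
    LinearMap.zero_apply, zero_add] at h
  exact h

/-- The image of the twisted differential of a Maurer-Cartan element is closed under the
Baker-Campbell-Hausdorff product. -/
theorem exists_lbch_twist_eq (hK : K.ActsNilp n) {y : K.V 1} (hy : K.MC1 y) (c c' : K.V (-1)) :
    ∃ c'', lbch (K.twist (y, 1) c) (K.twist (y, 1) c') = K.twist (y, 1) c'' := by
  have key : ∀ w, lnest (K.twist (y, 1) c) (K.twist (y, 1) c') w ∈
      LinearMap.range (K.twist (y, 1)) := by
    intro w
    induction w with
    | nil => exact Submodule.zero_mem _
    | cons b w ih =>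
      rcases w with _ | ⟨d, w⟩
      · cases b
        exacts [⟨c', rfl⟩, ⟨c, rfl⟩]
      · obtain ⟨e, he⟩ := ih
        rw [lnest_cons_cons, ← he]
        cases b
        exacts [⟨_, (lie_twist_twist hy c' e).symm⟩, ⟨_, (lie_twist_twist hy c e).symm⟩]
  have hmem : lbch (K.twist (y, 1) c) (K.twist (y, 1) c') ∈ LinearMap.range (K.twist (y, 1)) := by
    rw [lbch_eq_sum (N := n + 1) fun w hw => hK.ad.lnest_eq_zero _ _ hw]
    exact Submodule.sum_mem _ fun P _ => Submodule.smul_mem _ _ (key _)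
  obtain ⟨e, he⟩ := hmem
  exact ⟨e, he.symm⟩

end DGLA

section LbchGroup

variable {𝔤 : Type*} [LieRing 𝔤] [LieAlgebra ℂ 𝔤] {n : ℕ}

/-- The group structure given by the Baker-Campbell-Hausdorff product. -/
abbrev lbchGroup (h : ActsNilpotently (LieAlgebra.ad ℂ 𝔤) n) : Group 𝔤 :=
  let _ : Mul 𝔤 := ⟨lbch⟩
  let _ : Inv 𝔤 := ⟨Neg.neg⟩
  let _ : One 𝔤 := ⟨0⟩
  Group.ofLeftAxioms (lbch_assoc h) (lbch_zero_left h) (lbch_neg_left h)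

theorem lbch_zero_right (h : ActsNilpotently (LieAlgebra.ad ℂ 𝔤) n) (x : 𝔤) : lbch x 0 = x :=
  (lbchGroup h).mul_one x

theorem lbch_reverse (h : ActsNilpotently (LieAlgebra.ad ℂ 𝔤) n) (a b p t : 𝔤) :
    p = lbch (-b) (lbch (lbch b (lbch (-t) (-b))) (lbch (lbch b (lbch t (lbch p (-a))))
      (-(-a)))) := by
  let _ := lbchGroup h
  change p = b⁻¹ * ((b * (t⁻¹ * b⁻¹)) * ((b * (t * (p * a⁻¹))) * a⁻¹⁻¹))
  group

theorem lbch_compose (h : ActsNilpotently (LieAlgebra.ad ℂ 𝔤) n) (a₁ a₂ b₁ b₂ p t₁ t₂ : 𝔤) :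
    lbch b₂ (lbch t₂ (lbch (lbch b₁ (lbch t₁ (lbch p (-a₁)))) (-a₂))) =
      lbch (lbch b₂ b₁) (lbch (lbch (lbch (-b₁) (lbch t₂ (-(-b₁)))) t₁)
        (lbch p (-(lbch a₂ a₁)))) := by
  let _ := lbchGroup h
  change b₂ * (t₂ * ((b₁ * (t₁ * (p * a₁⁻¹))) * a₂⁻¹)) =
    (b₂ * b₁) * (((b₁⁻¹ * (t₂ * b₁⁻¹⁻¹)) * t₁) * (p * (a₂ * a₁)⁻¹))
  group

end LbchGroup

namespace GLDHom

variable {K K' : DGLA} (φ : GLDHom K.toGLD K'.toGLD)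

theorem f_brTo {i j k : ℤ} (h : i + j = k) (x : K.V i) (y : K.V j) :
    φ.f k (K.brTo h x y) = K'.brTo h (φ.f i x) (φ.f j y) := by
  subst h
  exact φ.f_br i j x y

theorem f_dTo {i k : ℤ} (h : i + 1 = k) (x : K.V i) :
    φ.f k (K.dTo h x) = K'.dTo h (φ.f i x) := by
  subst h
  exact φ.f_d i x

/-- The degree-zero component of a morphism, as a morphism of Lie algebras. -/
def lieZero : K.V 0 →ₗ⁅ℂ⁆ K'.V 0 :=
  { φ.lin 0 with map_lie' := fun {a b} => φ.f_brTo (zero_add 0) a b }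

theorem f_neg {i : ℤ} (x : K.V i) : φ.f i (-x) = -φ.f i x := map_neg (φ.lin i) x

theorem f_lbch {n : ℕ} (hK : K.ActsNilp n) (a b : K.V 0) :
    φ.f 0 (lbch a b) = lbch (φ.f 0 a) (φ.f 0 b) :=
  map_lbch_of_actsNilpotently hK.ad φ.lieZero a b

theorem f_gauge {n n' : ℕ} (hK : K.ActsNilp n) (hK' : K'.ActsNilp n') (a : K.V 0) (x : K.V 1) :
    φ.f 1 (K.gauge a x) = K'.gauge (φ.f 0 a) (φ.f 1 x) := by
  have h := nexp_apply_of_intertwine (hK.gaugeRep.isNilpotent a)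
    (hK'.gaugeRep.isNilpotent (φ.f 0 a)) ((φ.lin 1).prodMap LinearMap.id) (fun p => ?_) (x, 1)
  · rw [DGLA.nexp_gaugeRep hK] at h
    have h' := DGLA.nexp_gaugeRep hK' (φ.f 0 a) (φ.f 1 x)
    exact congrArg Prod.fst (h.symm.trans h')
  · obtain ⟨y, s⟩ := p
    have h1 : φ.lin 1 (K.rep 1 a y - s • K.dTo (zero_add 1) a) =
        K'.rep 1 (φ.f 0 a) (φ.f 1 y) - s • K'.dTo (zero_add 1) (φ.f 0 a) := by
      rw [map_sub, map_smul]
      exact congrArg₂ (fun u v => u - s • v) (φ.f_brTo _ a y) (φ.f_dTo _ a)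
    refine (K'.gaugeRep_apply (φ.f 0 a) (φ.f 1 y) s).trans ?_
    rw [DGLA.gaugeRep_apply, ← h1]
    rfl

theorem f_MC1 {x : K.V 1} (hx : K.MC1 x) : K'.MC1 (φ.f 1 x) := by
  have h := congrArg (φ.lin (1 + 1)) hx
  rw [map_add, map_smul, map_zero] at h
  refine Eq.trans ?_ h
  exact congrArg₂ (fun u v => u + (2 : ℂ)⁻¹ • v) (φ.f_d 1 x).symm (φ.f_br 1 1 x x).symm

end GLDHom

section TensorMaximalIdeal

variable (L M : DGLA) (A : Type) [CommRing A] [Algebra ℂ A] [IsLocalRing A]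

/-- Pure tensors in `L ⊗ m_A`. -/
def DGLA.tenMk {i : ℤ} (v : L.V i) (m : mA A) : (L.ten A).V i := v ⊗ₜ m

theorem DGLA.ten_tr_tenMk {i j : ℤ} (h : i = j) (v : L.V i) (m : mA A) :
    (L.ten A).tr h (L.tenMk A v m) = L.tenMk A (L.tr h v) m := by subst h; rfl

theorem mMul_comm (m m' : mA A) : mMul A m m' = mMul A m' m := Subtype.ext (mul_comm _ _)

theorem mMul_assoc (m m' m'' : mA A) : mMul A (mMul A m m') m'' = mMul A m (mMul A m' m'') :=
  Subtype.ext (mul_assoc _ _ _)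

theorem mMul_left_comm (m m' m'' : mA A) :
    mMul A m (mMul A m' m'') = mMul A m' (mMul A m m'') :=
  Subtype.ext (mul_left_comm _ _ _)

theorem DGLA.ten_induction {i : ℤ} {p : (L.ten A).V i → Prop} (x : (L.ten A).V i) (zero : p 0)
    (mk : ∀ (v : L.V i) (m : mA A), p (L.tenMk A v m)) (add : ∀ x y, p x → p y → p (x + y)) : p x :=
  TensorProduct.induction_on x zero mk add

/-- The differential of `L ⊗ m_A` as a linear map. -/
def DGLA.tenDLin (i : ℤ) : (L.ten A).V i →ₗ[ℂ] (L.ten A).V (i + 1) :=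
  LinearMap.rTensor (mA A) (L.dLin i)

/-- The bracket of `L ⊗ m_A` as a bilinear map. -/
def DGLA.tenBrLin (i j : ℤ) : (L.ten A).V i →ₗ[ℂ] (L.ten A).V j →ₗ[ℂ] (L.ten A).V (i + j) :=
  TensorProduct.curry
    ((TensorProduct.map (TensorProduct.lift (L.brLin i j)) (TensorProduct.lift (mMul A)))
      ∘ₗ (TensorProduct.tensorTensorTensorComm ℂ (L.V i) (mA A) (L.V j) (mA A)).toLinearMap)

theorem DGLA.ten_antisym (i j : ℤ) (x : (L.ten A).V i) (y : (L.ten A).V j) :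
    L.tenBrLin A i j x y = -(L.ten A).trLin (add_comm j i)
      (((Int.negOnePow (i * j) : ℤˣ) : ℤ) • L.tenBrLin A j i y x) := by
  induction x using DGLA.ten_induction with
  | zero => simp only [map_zero, LinearMap.zero_apply, smul_zero, neg_zero]
  | add a b ha hb => simp only [map_add, LinearMap.add_apply, smul_add, neg_add, ha, hb]
  | mk v m =>
    induction y using DGLA.ten_induction with
    | zero => simp only [map_zero, LinearMap.zero_apply, smul_zero, neg_zero]
    | add a b ha hb => simp only [map_add, LinearMap.add_apply, smul_add, neg_add, ha, hb]
    | mk w m' =>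
      rw [map_zsmul]
      refine (congrArg (· ⊗ₜ[ℂ] mMul A m m') (L.brTo_swap rfl (add_comm j i) v w)).trans ?_
      rw [TensorProduct.neg_tmul, ← TensorProduct.smul_tmul', mMul_comm]
      exact congrArg (fun z => -(((Int.negOnePow (i * j) : ℤˣ) : ℤ) • z))
        (L.ten_tr_tenMk A (add_comm j i) (L.br j i w v) (mMul A m' m)).symm

theorem DGLA.ten_d_sq (i : ℤ) (x : (L.ten A).V i) :
    L.tenDLin A (i + 1) (L.tenDLin A i x) = 0 := by
  induction x using DGLA.ten_induction with
  | zero => simp only [map_zero]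
  | add a b ha hb => simp only [map_add, ha, hb, add_zero]
  | mk v m => exact (congrArg (· ⊗ₜ[ℂ] m) (L.d_sq i v)).trans (TensorProduct.zero_tmul _ _)

theorem DGLA.ten_leibniz (i j : ℤ) (x : (L.ten A).V i) (y : (L.ten A).V j) :
    L.tenDLin A (i + j) (L.tenBrLin A i j x y) =
      (L.ten A).trLin (by omega) (L.tenBrLin A (i + 1) j (L.tenDLin A i x) y) +
        ((Int.negOnePow i : ℤˣ) : ℤ) •
          (L.ten A).trLin (by omega) (L.tenBrLin A i (j + 1) x (L.tenDLin A j y)) := by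
  induction x using DGLA.ten_induction with
  | zero => simp only [map_zero, LinearMap.zero_apply, smul_zero, add_zero]
  | add a b ha hb =>
    simp only [map_add, LinearMap.add_apply, smul_add, ha, hb]
    exact add_add_add_comm _ _ _ _
  | mk v m =>
    induction y using DGLA.ten_induction with
    | zero => simp only [map_zero, smul_zero, add_zero]
    | add a b ha hb =>
      simp only [map_add, smul_add, ha, hb]
      exact add_add_add_comm _ _ _ _
    | mk w m' =>
      refine (congrArg (· ⊗ₜ[ℂ] mMul A m m') (L.leibniz i j v w)).trans ?_
      rw [TensorProduct.add_tmul, ← TensorProduct.smul_tmul']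
      exact congrArg₂ (fun u u' => u + ((Int.negOnePow i : ℤˣ) : ℤ) • u')
        (L.ten_tr_tenMk A _ _ (mMul A m m')).symm (L.ten_tr_tenMk A _ _ (mMul A m m')).symm

theorem DGLA.ten_jacobi (i j k : ℤ) (x : (L.ten A).V i) (y : (L.ten A).V j)
    (z : (L.ten A).V k) :
    L.tenBrLin A i (j + k) x (L.tenBrLin A j k y z) =
      (L.ten A).trLin (by omega) (L.tenBrLin A (i + j) k (L.tenBrLin A i j x y) z) +
        ((Int.negOnePow (i * j) : ℤˣ) : ℤ) •
          (L.ten A).trLin (by omega) (L.tenBrLin A j (i + k) y (L.tenBrLin A i k x z)) := by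
  induction x using DGLA.ten_induction with
  | zero => simp only [map_zero, LinearMap.zero_apply, smul_zero, add_zero]
  | add a b ha hb =>
    simp only [map_add, LinearMap.add_apply, smul_add, ha, hb]
    exact add_add_add_comm _ _ _ _
  | mk u m =>
    induction y using DGLA.ten_induction with
    | zero => simp only [map_zero, LinearMap.zero_apply, smul_zero, add_zero]
    | add a b ha hb =>
      simp only [map_add, LinearMap.add_apply, smul_add, ha, hb]
      exact add_add_add_comm _ _ _ _
    | mk v m' =>
      induction z using DGLA.ten_induction with
      | zero => simp only [map_zero, smul_zero, add_zero]
      | add a b ha hb =>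
        simp only [map_add, smul_add, ha, hb]
        exact add_add_add_comm _ _ _ _
      | mk w m'' =>
        refine (congrArg (· ⊗ₜ[ℂ] mMul A m (mMul A m' m'')) (L.jacobi i j k u v w)).trans ?_
        rw [TensorProduct.add_tmul, ← TensorProduct.smul_tmul']
        nth_rewrite 1 [← mMul_assoc]
        rw [mMul_left_comm]
        exact congrArg₂ (fun u u' => u + ((Int.negOnePow (i * j) : ℤˣ) : ℤ) • u')
          (L.ten_tr_tenMk A _ _ (mMul A (mMul A m m') m'')).symm
          (L.ten_tr_tenMk A _ _ (mMul A m' (mMul A m m''))).symm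

/-- The DGLA structure on `L ⊗ m_A`. -/
def DGLA.tenD : DGLA where
  toGLD := L.ten A
  d_add i x y := (L.tenDLin A i).map_add x y
  d_smul i c x := (L.tenDLin A i).map_smul c x
  br_add_left i j x x' y := (L.tenBrLin A i j).map_add₂ x x' y
  br_smul_left i j c x y := (L.tenBrLin A i j).map_smul₂ c x y
  br_add_right i j x y y' := (L.tenBrLin A i j x).map_add y y'
  br_smul_right i j c x y := (L.tenBrLin A i j x).map_smul c y
  d_sq i x := L.ten_d_sq A i x
  antisym i j x y := L.ten_antisym A i j x y
  leibniz i j x y := L.ten_leibniz A i j x y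
  jacobi i j k x y z := L.ten_jacobi A i j k x y z

theorem DGLA.tenD_induction {i : ℤ} {p : (L.tenD A).V i → Prop} (x : (L.tenD A).V i)
    (zero : p 0) (mk : ∀ (v : L.V i) (m : mA A), p (L.tenMk A v m))
    (add : ∀ x y, p x → p y → p (x + y)) : p x :=
  TensorProduct.induction_on x zero mk add

theorem DGLA.tenD_rep_tenMk {i : ℤ} (u : L.V 0) (v : L.V i) (m m' : mA A) :
    (L.tenD A).rep i (L.tenMk A u m) (L.tenMk A v m') = L.tenMk A (L.rep i u v) (mMul A m m') :=
  L.ten_tr_tenMk A (zero_add i) (L.br 0 i u v) (mMul A m m')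

theorem DGLA.exists_actsNilp_tenD [IsArtinianRing A] : ∃ n, (L.tenD A).ActsNilp n := by
  obtain ⟨n, hn⟩ : IsNilpotent (mA A) := by
    rw [mA, ← IsLocalRing.jacobson_eq_maximalIdeal ⊥ bot_ne_top]
    exact IsArtinianRing.isNilpotent_jacobson_bot
  refine ⟨n, fun i => ?_⟩
  have key : ∀ (l : List ((L.tenD A).V 0)) (t : (L.tenD A).V i),
      (l.map ((L.tenD A).rep i)).prod t ∈ Submodule.span ℂ
        {r : (L.tenD A).V i | ∃ (v : L.V i) (m : mA A), m.1 ∈ mA A ^ l.length ∧ r = L.tenMk A v m} := by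
    intro l t
    induction l with
    | nil =>
      induction t using DGLA.tenD_induction with
      | zero => rw [map_zero]; exact Submodule.zero_mem _
      | add a b ha hb => rw [map_add]; exact Submodule.add_mem _ ha hb
      | mk v m => exact Submodule.subset_span ⟨v, m, by simp, rfl⟩
    | cons u l ih =>
      rw [List.map_cons, List.prod_cons, Module.End.mul_apply]
      generalize (l.map ((L.tenD A).rep i)).prod t = s at ih
      induction ih using Submodule.span_induction with
      | zero => rw [map_zero]; exact Submodule.zero_mem _
      | add a b _ _ ha hb => rw [map_add]; exact Submodule.add_mem _ ha hb
      | smul c a _ ha => rw [map_smul]; exact Submodule.smul_mem _ _ ha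
      | mem r hr =>
        obtain ⟨v, m, hm, rfl⟩ := hr
        induction u using DGLA.tenD_induction with
        | zero => rw [map_zero]; exact Submodule.zero_mem _
        | add a b ha hb => rw [map_add]; exact Submodule.add_mem _ ha hb
        | mk u m' =>
          refine Submodule.subset_span ⟨_, mMul A m' m, ?_, L.tenD_rep_tenMk A u v m' m⟩
          have := Ideal.mul_mem_mul m'.2 hm
          rwa [← pow_succ'] at this
  intro l hl
  refine LinearMap.ext fun t => (Submodule.span_eq_bot.2 ?_).le (key l t)
  rintro _ ⟨v, m, hm, rfl⟩
  have hm0 : m = 0 := by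
    have := Ideal.pow_le_pow_right hl hm
    rw [hn] at this
    exact Subtype.ext this
  rw [hm0]
  exact TensorProduct.tmul_zero _ _

variable {L M}

/-- The components of the extension of a morphism to coefficients in `m_A`, as linear maps. -/
def GLDHom.tenLin (φ : GLDHom L.toGLD M.toGLD) (i : ℤ) : (L.ten A).V i →ₗ[ℂ] (M.ten A).V i :=
  LinearMap.rTensor (mA A) (φ.lin i)

theorem GLDHom.tenLin_d (φ : GLDHom L.toGLD M.toGLD) (i : ℤ) (x : (L.ten A).V i) :
    φ.tenLin A (i + 1) (L.tenDLin A i x) = M.tenDLin A i (φ.tenLin A i x) := by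
  induction x using DGLA.ten_induction with
  | zero => simp only [map_zero]
  | add a b ha hb => simp only [map_add, ha, hb]
  | mk v m => exact congrArg (· ⊗ₜ[ℂ] m) (φ.f_d i v)

theorem GLDHom.tenLin_br (φ : GLDHom L.toGLD M.toGLD) (i j : ℤ) (x : (L.ten A).V i)
    (y : (L.ten A).V j) : φ.tenLin A (i + j) (L.tenBrLin A i j x y) =
      M.tenBrLin A i j (φ.tenLin A i x) (φ.tenLin A j y) := by
  induction x using DGLA.ten_induction with
  | zero => simp only [map_zero, LinearMap.zero_apply]
  | add a b ha hb => simp only [map_add, LinearMap.add_apply, ha, hb]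
  | mk v m =>
    induction y using DGLA.ten_induction with
    | zero => simp only [map_zero]
    | add a b ha hb => simp only [map_add, ha, hb]
    | mk w m' => exact congrArg (· ⊗ₜ[ℂ] mMul A m m') (φ.f_br i j v w)

/-- The extension of a morphism of DGLAs to coefficients in `m_A`. -/
def GLDHom.ten (φ : GLDHom L.toGLD M.toGLD) : GLDHom (L.tenD A).toGLD (M.tenD A).toGLD where
  f i := φ.tenLin A i
  f_add i x y := (φ.tenLin A i).map_add x y
  f_smul i c x := (φ.tenLin A i).map_smul c x
  f_d i x := φ.tenLin_d A i x
  f_br i j x y := φ.tenLin_br A i j x y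

end TensorMaximalIdeal

section GaugeEquivalence

variable {L M N : DGLA} {φ : GLDHom L.toGLD M.toGLD} {ψ : GLDHom N.toGLD M.toGLD}

/-- `(a, b, c)` carries the triple `w` to the triple `w'`. -/
def GaugeStep (φ : GLDHom L.toGLD M.toGLD) (ψ : GLDHom N.toGLD M.toGLD)
    (w w' : L.V 1 × N.V 1 × M.V 0) (a : L.V 0) (b : N.V 0) (c : M.V (-1)) : Prop :=
  w'.1 = L.gauge a w.1 ∧ w'.2.1 = N.gauge b w.2.1 ∧
    w'.2.2 = lbch (ψ.f 0 b) (lbch (M.twist (ψ.f 1 w.2.1, 1) c) (lbch w.2.2 (-φ.f 0 a)))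

variable {l m n : ℕ} {w w' w'' : L.V 1 × N.V 1 × M.V 0}

theorem gaugeStep_refl (hL : L.ActsNilp l) (hM : M.ActsNilp m) (hN : N.ActsNilp n)
    (w : L.V 1 × N.V 1 × M.V 0) : GaugeStep φ ψ w w 0 0 0 := by
  refine ⟨(DGLA.gauge_zero hL _).symm, (DGLA.gauge_zero hN _).symm, ?_⟩
  have h1 : ψ.f 0 0 = 0 := (ψ.lin 0).map_zero
  have h2 : φ.f 0 0 = 0 := (φ.lin 0).map_zero
  rw [h1, h2, map_zero, neg_zero, lbch_zero_left hM.ad, lbch_zero_left hM.ad,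
    lbch_zero_right hM.ad]

theorem GaugeStep.symm (hL : L.ActsNilp l) (hM : M.ActsNilp m) (hN : N.ActsNilp n)
    {a : L.V 0} {b : N.V 0} {c : M.V (-1)} (h : GaugeStep φ ψ w w' a b c) :
    GaugeStep φ ψ w' w (-a) (-b) (nexp (M.rep (-1) (ψ.f 0 b)) (-c)) := by
  obtain ⟨h1, h2, h3⟩ := h
  refine ⟨by rw [h1, DGLA.gauge_neg_gauge hL], by rw [h2, DGLA.gauge_neg_gauge hN], ?_⟩
  rw [h3, h2, ψ.f_gauge hN hM, ← DGLA.nexp_ad_twist hM, ← lbch_conj hM.ad, map_neg, ψ.f_neg,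
    φ.f_neg]
  exact lbch_reverse hM.ad _ _ _ _

theorem GaugeStep.trans (hL : L.ActsNilp l) (hM : M.ActsNilp m) (hN : N.ActsNilp n)
    (hw : N.MC1 w.2.1) {a₁ a₂ : L.V 0} {b₁ b₂ : N.V 0} {c₁ c₂ : M.V (-1)}
    (h : GaugeStep φ ψ w w' a₁ b₁ c₁) (h' : GaugeStep φ ψ w' w'' a₂ b₂ c₂) :
    ∃ c, GaugeStep φ ψ w w'' (lbch a₂ a₁) (lbch b₂ b₁) c := by
  obtain ⟨h1, h2, h3⟩ := h
  obtain ⟨h1', h2', h3'⟩ := h'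
  obtain ⟨c, hc⟩ := DGLA.exists_lbch_twist_eq hM (ψ.f_MC1 hw)
    (nexp (M.rep (-1) (-ψ.f 0 b₁)) c₂) c₁
  have hconj : lbch (-ψ.f 0 b₁) (lbch (M.twist (ψ.f 1 w'.2.1, 1) c₂) (-(-ψ.f 0 b₁))) =
      M.twist (ψ.f 1 w.2.1, 1) (nexp (M.rep (-1) (-ψ.f 0 b₁)) c₂) := by
    rw [lbch_conj hM.ad, DGLA.nexp_ad_twist hM, h2, ψ.f_gauge hN hM, DGLA.gauge_neg_gauge hM]
  refine ⟨c, by rw [h1', h1, DGLA.gauge_lbch hL], by rw [h2', h2, DGLA.gauge_lbch hN], ?_⟩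
  rw [h3', h3, lbch_compose hM.ad, hconj, hc, ψ.f_lbch hN, φ.f_lbch hL]

end GaugeEquivalence

theorem DGLA.bch_twist (K : DGLA) (p q r : K.V 0) (y : K.V 1) (c : K.V (-1)) :
    K.bch p (K.bch (K.tr (show (-1 : ℤ) + 1 = 0 by omega) (K.d (-1) c) +
      K.tr (show (1 : ℤ) + -1 = 0 by omega) (K.br 1 (-1) y c)) (K.bch q r)) =
      lbch p (lbch (K.twist (y, 1) c) (lbch q r)) := by
  rw [bch_eq_lbch, bch_eq_lbch, bch_eq_lbch, twist_apply, one_smul, add_comm]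
  rfl

theorem gaugeRel_iff {L M N : DGLA} (h : GLDHom L.toGLD M.toGLD) (g : GLDHom N.toGLD M.toGLD)
    (A : Type) [CommRing A] [Algebra ℂ A] [IsLocalRing A] (w w' : TripleSp L M N A) :
    gaugeRel L M N h g A w w' ↔ ∃ a b c, GaugeStep (h.ten A) (g.ten A) w w' a b c :=
  exists_congr fun a => exists_congr fun b => exists_congr fun c =>
    and_congr Iff.rfl <| and_congr Iff.rfl <| Eq.to_iff <| congrArg (w'.2.2 = ·) <|
      (M.tenD A).bch_twist ((g.ten A).f 0 b) w.2.2 (-(h.ten A).f 0 a) ((g.ten A).f 1 w.2.1) c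

/-- Let `h : L → M` and `g : N → M` be morphisms of DGLAs over `ℂ` and `(A, m_A)` a local
Artinian `ℂ`-algebra with residue field `ℂ`. The relation `∼` on `MC_{(h,g)}(A)` given by
`(x₁,y₁,e^{p₁}) ∼ (x₂,y₂,e^{p₂})` iff there exist `a ∈ L⁰ ⊗ m_A`, `b ∈ N⁰ ⊗ m_A` and
`c ∈ M⁻¹ ⊗ m_A` with `x₂ = e^a * x₁`, `y₂ = e^b * y₁` and
`e^{p₂} = e^{g(b)} e^T e^{p₁} e^{−h(a)}`, `T = dc + [g(y₁), c]`, is an equivalence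
relation. -/
theorem statement2 (L M N : DGLA) (h : GLDHom L.toGLD M.toGLD) (g : GLDHom N.toGLD M.toGLD)
    (A : Type) [CommRing A] [Algebra ℂ A] [IsLocalRing A] [IsArtinianRing A]
    (hres : Function.Bijective (algebraMap ℂ (IsLocalRing.ResidueField A))) :
    Equivalence (fun (w w' : {w : TripleSp L M N A // w ∈ MCset L M N h g A}) =>
      gaugeRel L M N h g A w.1 w'.1) := by
  obtain ⟨_, hL⟩ := L.exists_actsNilp_tenD A
  obtain ⟨_, hM⟩ := M.exists_actsNilp_tenD A
  obtain ⟨_, hN⟩ := N.exists_actsNilp_tenD A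
  simp only [gaugeRel_iff]
  refine ⟨fun w => ⟨0, 0, 0, gaugeStep_refl hL hM hN _⟩, ?_, ?_⟩
  · rintro _ _ ⟨a, b, c, hc⟩
    exact ⟨_, _, _, hc.symm hL hM hN⟩
  · rintro w _ _ ⟨a₁, b₁, c₁, h₁⟩ ⟨a₂, b₂, c₂, h₂⟩
    exact ⟨_, _, h₁.trans hL hM hN w.2.2.1 h₂⟩
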